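/- arXiv:1805.05411 — 3 statements merged into one kernel-verified Lean document; each statement's English description precedes it below -/
import Mathlib

section
/- (Theorem 3, main convergence of RapDual.) Suppose the number s of inner RaDual iterations satisfies (4 + 2L/μ)·αˢ ≤ min{1/2, μ²/L²} (this holds in particular when αˢ ≤ 1/(2M̂) with M̂ = (2 + L/μ)·max{2, L²/μ²}). Then: (1) 𝔼[ d(∇f(x_*^{ℓ̂}) + 𝐀ᵀλ^{ℓ̂}, −N_X(x_*^{ℓ̂}))² ] ≤ (8μ/k)·D⁰; (2) 𝔼[ ‖∇f_m(x̄_m^{ℓ̂}) + λ^{ℓ̂}‖² ] ≤ (34μ/k)·D⁰; (3) 𝔼[ ‖x̄^{ℓ̂} − x_*^{ℓ̂}‖² ] ≤ (2μ/(kL²))·D⁰; (4) 𝔼[ ‖𝐀x̄^{ℓ̂} + x̄_m^{ℓ̂} − b‖² ] ≤ (2(‖𝐀‖² + 1)μ/(kL²))·D⁰. Here ∇f(x) denotes the vector whose i-th block is ∇f_i(x_i). -/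
open RealInnerProductSpace Finset

/-- Bregman divergence associated with a differentiable function `h`. -/
noncomputable def breg {n : ℕ} (h : EuclideanSpace ℝ (Fin n) → ℝ)
    (x y : EuclideanSpace ℝ (Fin n)) : ℝ :=
  h x - h y - ⟪gradient h y, x - y⟫

set_option linter.unusedSectionVars false
set_option linter.unusedVariables false
section helpers

variable {F : Type*} [NormedAddCommGroup F] [InnerProductSpace ℝ F] [CompleteSpace F]

theorem rd_firstorder (q : F → ℝ) (g x z : F) (X : Set F) (hX : Convex ℝ X) (hx : x ∈ X)
    (hz : z ∈ X) (hg : HasGradientAt q g x) (hmin : ∀ y ∈ X, q x ≤ q y) :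
    0 ≤ ⟪g, z - x⟫ := by
  have h1 : IsLocalMinOn q X x := IsMinOn.localize (fun y hy => hmin y hy)
  have h2 := h1.hasFDerivWithinAt_nonneg (hg.hasFDerivAt.hasFDerivWithinAt)
    (sub_mem_posTangentConeAt_of_segment_subset (hX.segment_subset hx hz))
  simpa using h2

theorem rd_grad_normsq (c x : F) (a : ℝ) :
    HasGradientAt (fun z : F => a * ‖z - c‖ ^ 2) ((2 * a) • (x - c)) x := by
  rw [hasGradientAt_iff_hasFDerivAt]
  have h1 : HasFDerivAt (fun z : F => z - c) (ContinuousLinearMap.id ℝ F) x :=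
    (hasFDerivAt_id x).sub_const c
  have h2 := (h1.norm_sq).const_mul a
  refine h2.congr_fderiv ?_
  ext v
  simp
  ring

theorem rd_grad_inner (v x : F) : HasGradientAt (fun z : F => ⟪v, z⟫) v x := by
  rw [hasGradientAt_iff_hasFDerivAt]
  exact (InnerProductSpace.toDual ℝ F v).hasFDerivAt

theorem rd_grad_add {p q : F → ℝ} {g g' x : F} (hp : HasGradientAt p g x)
    (hq : HasGradientAt q g' x) : HasGradientAt (fun z => p z + q z) (g + g') x := by
  rw [hasGradientAt_iff_hasFDerivAt] at *
  refine (hp.add hq).congr_fderiv ?_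
  simp

theorem rd_grad_smul {p : F → ℝ} {g x : F} (a : ℝ) (hp : HasGradientAt p g x) :
    HasGradientAt (fun z => a * p z) (a • g) x := by
  rw [hasGradientAt_iff_hasFDerivAt] at *
  refine (hp.const_mul a).congr_fderiv ?_
  simp

theorem rd_grad_prox (f : F → ℝ) (hf : Differentiable ℝ f) (c x : F) (a : ℝ) :
    gradient (fun z => f z + a * ‖z - c‖ ^ 2) x = gradient f x + (2 * a) • (x - c) :=
  (rd_grad_add (hf x).hasGradientAt (rd_grad_normsq c x a)).gradient

theorem rd_norm_sub_expand (z x c : F) :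
    ‖z - c‖ ^ 2 = ‖x - c‖ ^ 2 + 2 * ⟪x - c, z - x⟫ + ‖z - x‖ ^ 2 := by
  have : z - c = (x - c) + (z - x) := by abel
  rw [this, norm_add_sq_real]

theorem rd_block_min (f : F → ℝ) (hf : Differentiable ℝ f) (X : Set F) (hX : Convex ℝ X)
    (μ η : ℝ)
    (hw : ∀ x ∈ X, ∀ y ∈ X, f x - f y - ⟪gradient f y, x - y⟫ ≥ -(μ / 2) * ‖x - y‖ ^ 2)
    (c c' v x : F) (hx : x ∈ X)
    (hmin : ∀ z ∈ X, f x + μ * ‖x - c‖ ^ 2 + ⟪v, x⟫ + η / 2 * ‖x - c'‖ ^ 2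
      ≤ f z + μ * ‖z - c‖ ^ 2 + ⟪v, z⟫ + η / 2 * ‖z - c'‖ ^ 2) (z : F) (hz : z ∈ X) :
    f x + μ * ‖x - c‖ ^ 2 + ⟪v, x⟫ + η / 2 * ‖x - c'‖ ^ 2 + (μ + η) / 2 * ‖x - z‖ ^ 2
      ≤ f z + μ * ‖z - c‖ ^ 2 + ⟪v, z⟫ + η / 2 * ‖z - c'‖ ^ 2 := by
  have hg := rd_grad_add (rd_grad_add (rd_grad_add (hf x).hasGradientAt (rd_grad_normsq c x μ))
    (rd_grad_inner v x)) (rd_grad_normsq c' x (η / 2))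
  have h1 := rd_firstorder _ _ x z X hX hx hz hg hmin
  have h2 := hw z hz x hx
  rw [rd_norm_sub_expand z x c, rd_norm_sub_expand z x c', norm_sub_rev x z]
  simp only [inner_add_left, real_inner_smul_left, inner_sub_right] at *
  nlinarith

theorem rd_block_unique (f : F → ℝ) (hf : Differentiable ℝ f) (X : Set F) (hX : Convex ℝ X)
    (μ η : ℝ) (hμ : 0 < μ) (hη : 0 ≤ η)
    (hw : ∀ x ∈ X, ∀ y ∈ X, f x - f y - ⟪gradient f y, x - y⟫ ≥ -(μ / 2) * ‖x - y‖ ^ 2)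
    (c c' v x x' : F) (hx : x ∈ X) (hx' : x' ∈ X)
    (hmin : ∀ z ∈ X, f x + μ * ‖x - c‖ ^ 2 + ⟪v, x⟫ + η / 2 * ‖x - c'‖ ^ 2
      ≤ f z + μ * ‖z - c‖ ^ 2 + ⟪v, z⟫ + η / 2 * ‖z - c'‖ ^ 2)
    (hmin' : ∀ z ∈ X, f x' + μ * ‖x' - c‖ ^ 2 + ⟪v, x'⟫ + η / 2 * ‖x' - c'‖ ^ 2
      ≤ f z + μ * ‖z - c‖ ^ 2 + ⟪v, z⟫ + η / 2 * ‖z - c'‖ ^ 2) : x = x' := by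
  have h1 := rd_block_min f hf X hX μ η hw c c' v x hx hmin x' hx'
  have h2 := hmin' x hx
  have h3 : (μ + η) / 2 * ‖x - x'‖ ^ 2 ≤ 0 := by linarith
  have h4 : ‖x - x'‖ ^ 2 ≤ 0 := by
    by_contra hcon
    push Not at hcon
    have : 0 < (μ + η) / 2 * ‖x - x'‖ ^ 2 := by positivity
    linarith
  have h5 : ‖x - x'‖ = 0 := by
    have := sq_nonneg ‖x - x'‖
    exact pow_eq_zero_iff (two_ne_zero) |>.1 (le_antisymm h4 this)
  exact sub_eq_zero.1 (norm_eq_zero.1 h5)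

/-- three point identity for the dual step -/
theorem rd_three_point (h : F → ℝ) (hd : Differentiable ℝ h) (τ : ℝ) (r yp ym : F)
    (hmin : ∀ y, h yp + ⟪r, yp⟫ + τ * (h yp - h ym - ⟪gradient h ym, yp - ym⟫)
      ≤ h y + ⟪r, y⟫ + τ * (h y - h ym - ⟪gradient h ym, y - ym⟫)) (y : F) :
    h yp + ⟪r, yp⟫ + τ * (h yp - h ym - ⟪gradient h ym, yp - ym⟫)
      + (1 + τ) * (h y - h yp - ⟪gradient h yp, y - yp⟫)
      = h y + ⟪r, y⟫ + τ * (h y - h ym - ⟪gradient h ym, y - ym⟫) := by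
  have hg := rd_grad_add (rd_grad_add (hd yp).hasGradientAt (rd_grad_inner r yp))
    (rd_grad_smul τ (rd_grad_add (hd yp).hasGradientAt (rd_grad_inner (-gradient h ym) yp)))
  have hmin2 : ∀ z ∈ (Set.univ : Set F),
      h yp + ⟪r, yp⟫ + τ * (h yp + ⟪-gradient h ym, yp⟫)
        ≤ h z + ⟪r, z⟫ + τ * (h z + ⟪-gradient h ym, z⟫) := by
    intro z _
    have := hmin z
    simp only [inner_sub_right, inner_neg_left] at *
    nlinarith
  have h0 : ∀ z, 0 ≤ ⟪_, z - yp⟫ := fun z =>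
    rd_firstorder _ _ yp z Set.univ convex_univ trivial trivial hg hmin2
  have h1 := h0 y
  have h2 := h0 (yp - (y - yp))
  simp only [inner_add_left, real_inner_smul_left, inner_sub_right, inner_neg_left] at *
  nlinarith

theorem rd_dual_unique (h : F → ℝ) (hd : Differentiable ℝ h) (τ κ : ℝ) (hτ : 0 ≤ τ) (hκ : 0 < κ)
    (hsc : ∀ y y', h y - h y' - ⟪gradient h y', y - y'⟫ ≥ κ * ‖y - y'‖ ^ 2) (r yp yp' ym : F)
    (hmin : ∀ y, h yp + ⟪r, yp⟫ + τ * (h yp - h ym - ⟪gradient h ym, yp - ym⟫)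
      ≤ h y + ⟪r, y⟫ + τ * (h y - h ym - ⟪gradient h ym, y - ym⟫))
    (hmin' : ∀ y, h yp' + ⟪r, yp'⟫ + τ * (h yp' - h ym - ⟪gradient h ym, yp' - ym⟫)
      ≤ h y + ⟪r, y⟫ + τ * (h y - h ym - ⟪gradient h ym, y - ym⟫)) : yp = yp' := by
  have h1 := rd_three_point h hd τ r yp ym hmin yp'
  have h2 := hmin' yp
  have h3 := hsc yp' yp
  have h4 : ‖yp' - yp‖ ^ 2 ≤ 0 := by
    by_contra hcon
    push Not at hcon
    have h5 : 0 < κ * ‖yp' - yp‖ ^ 2 := by positivity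
    have : 0 < (1 + τ) * (h yp' - h yp - ⟪gradient h yp, yp' - yp⟫) :=
      mul_pos (by linarith) (by linarith)
    linarith
  have h5 : ‖yp' - yp‖ = 0 :=
    pow_eq_zero_iff (two_ne_zero) |>.1 (le_antisymm h4 (sq_nonneg _))
  exact (sub_eq_zero.1 (norm_eq_zero.1 h5)).symm

/-- descent lemma -/
theorem rd_descent (f : F → ℝ) (hf : Differentiable ℝ f) (L : ℝ)
    (hL : ∀ x y : F, ‖gradient f x - gradient f y‖ ≤ L * ‖x - y‖) (x y : F) :
    f x - f y - ⟪gradient f y, x - y⟫ ≤ L / 2 * ‖x - y‖ ^ 2 := by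
  let g : ℝ → ℝ := fun t => f (y + t • (x - y)) - t * ⟪gradient f y, x - y⟫
    - L / 2 * ‖x - y‖ ^ 2 * t ^ 2
  have hg : ∀ t, HasDerivAt g (⟪gradient f (y + t • (x - y)), x - y⟫
      - ⟪gradient f y, x - y⟫ - L / 2 * ‖x - y‖ ^ 2 * (2 * t)) t := by
    intro t
    have h1 : HasDerivAt (fun t : ℝ => y + t • (x - y)) (x - y) t := by
      simpa using ((hasDerivAt_id t).smul_const (x - y)).const_add y
    have h2 := ((hf (y + t • (x - y))).hasGradientAt.hasFDerivAt).comp_hasDerivAt t h1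
    have h3 := (h2.sub ((hasDerivAt_id t).mul_const ⟪gradient f y, x - y⟫)).sub
      ((hasDerivAt_pow 2 t).const_mul (L / 2 * ‖x - y‖ ^ 2))
    refine h3.congr_deriv ?_
    simp
  have hanti : AntitoneOn g (Set.Icc 0 1) := by
    apply antitoneOn_of_deriv_nonpos (convex_Icc 0 1)
    · exact fun t _ => (hg t).continuousAt.continuousWithinAt
    · exact fun t _ => (hg t).differentiableAt.differentiableWithinAt
    · intro t ht
      rw [interior_Icc] at ht
      rw [(hg t).deriv]
      have h1 := real_inner_le_norm (gradient f (y + t • (x - y)) - gradient f y) (x - y)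
      have h2 := hL (y + t • (x - y)) y
      rw [add_sub_cancel_left, norm_smul, Real.norm_of_nonneg ht.1.le] at h2
      rw [inner_sub_left] at h1
      have h3 := mul_le_mul_of_nonneg_right h2 (norm_nonneg (x - y))
      nlinarith
  have := hanti (by simp : (0 : ℝ) ∈ Set.Icc (0 : ℝ) 1) (by simp : (1 : ℝ) ∈ Set.Icc (0 : ℝ) 1)
    zero_le_one
  simp only [g, one_smul, add_sub_cancel, zero_smul, add_zero] at this
  linarith

/-- conjugate function facts -/
theorem rd_conj (f : F → ℝ) (hf : Differentiable ℝ f) (μ : ℝ) (hμ : 0 < μ)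
    (hw : ∀ x y, f x - f y - ⟪gradient f y, x - y⟫ ≥ -(μ / 2) * ‖x - y‖ ^ 2) (c : F)
    (h : F → ℝ) (hd : Differentiable ℝ h)
    (hdef : ∀ y, h y = ⨆ w : F, (⟪-y, w⟫ - (f w + μ * ‖w - c‖ ^ 2)))
    (y w : F) (hy : y = - (gradient f w + (2 * μ) • (w - c))) :
    h y = -⟪y, w⟫ - (f w + μ * ‖w - c‖ ^ 2) ∧ gradient h y = -w := by
  have hq : ∀ u, f u + μ * ‖u - c‖ ^ 2 ≥ f w + μ * ‖w - c‖ ^ 2 - ⟪y, u - w⟫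
      + μ / 2 * ‖u - w‖ ^ 2 := by
    intro u
    have h1 := hw u w
    rw [rd_norm_sub_expand u w c, hy]
    simp only [inner_neg_left, inner_add_left, real_inner_smul_left]
    nlinarith
  have hbdd : ∀ z, BddAbove (Set.range fun u : F => (⟪-z, u⟫ - (f u + μ * ‖u - c‖ ^ 2))) := by
    intro z
    refine ⟨-⟪z, w⟫ - (f w + μ * ‖w - c‖ ^ 2) + ‖y - z‖ ^ 2 / (2 * μ), ?_⟩
    rintro _ ⟨u, rfl⟩
    have h1 := hq u
    have h2 := real_inner_le_norm (y - z) (u - w)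
    have h3 : ‖y - z‖ * ‖u - w‖ ≤ ‖y - z‖ ^ 2 / (2 * μ) + μ / 2 * ‖u - w‖ ^ 2 := by
      have : 0 ≤ (‖y - z‖ - μ * ‖u - w‖) ^ 2 / (2 * μ) := by positivity
      have e : (‖y - z‖ - μ * ‖u - w‖) ^ 2 / (2 * μ) = ‖y - z‖ ^ 2 / (2 * μ) + μ / 2 * ‖u - w‖ ^ 2
        - ‖y - z‖ * ‖u - w‖ := by field_simp; ring
      linarith
    simp only [inner_neg_left, inner_sub_left, inner_sub_right] at *
    linarith
  have hlow : ∀ z, -⟪z, w⟫ - (f w + μ * ‖w - c‖ ^ 2) ≤ h z := by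
    intro z
    rw [hdef z, ← inner_neg_left]
    exact le_ciSup (hbdd z) w
  have hval : h y = -⟪y, w⟫ - (f w + μ * ‖w - c‖ ^ 2) := by
    refine le_antisymm ?_ (hlow y)
    rw [hdef y]
    apply ciSup_le
    intro u
    have h1 := hq u
    have h2 : 0 ≤ μ / 2 * ‖u - w‖ ^ 2 := by positivity
    simp only [inner_neg_left, inner_sub_right] at *
    linarith
  refine ⟨hval, ?_⟩
  have hg := rd_grad_add (hd y).hasGradientAt (rd_grad_inner w y)
  have h0 := fun z => rd_firstorder _ _ y z Set.univ convex_univ trivial trivial hg (by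
    intro z _
    have := hlow z
    rw [hval]
    have e1 := real_inner_comm y w
    have e2 := real_inner_comm z w
    linarith)
  have h1 := h0 (y - (gradient h y + w))
  have h2 : y - (gradient h y + w) - y = -(gradient h y + w) := by abel
  rw [h2, inner_neg_right, real_inner_self_eq_norm_sq] at h1
  have h3 : ‖gradient h y + w‖ ^ 2 = 0 := le_antisymm (by linarith) (sq_nonneg _)
  have h4 := norm_eq_zero.1 (pow_eq_zero_iff (two_ne_zero) |>.1 h3)
  exact eq_neg_of_add_eq_zero_left h4

theorem rd_conj_breg (f : F → ℝ) (hf : Differentiable ℝ f) (μ : ℝ) (hμ : 0 < μ)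
    (hw : ∀ x y, f x - f y - ⟪gradient f y, x - y⟫ ≥ -(μ / 2) * ‖x - y‖ ^ 2) (c : F)
    (h : F → ℝ) (hd : Differentiable ℝ h)
    (hdef : ∀ y, h y = ⨆ w : F, (⟪-y, w⟫ - (f w + μ * ‖w - c‖ ^ 2)))
    (y w : F) (hy : y = - (gradient f w + (2 * μ) • (w - c)))
    (l ws : F) (hl : l = - (gradient f ws + (2 * μ) • (ws - c))) :
    h l - h y - ⟪gradient h y, l - y⟫ = f w - f ws - ⟪gradient f ws, w - ws⟫ + μ * ‖w - ws‖ ^ 2 := by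
  obtain ⟨h1, h2⟩ := rd_conj f hf μ hμ hw c h hd hdef y w hy
  obtain ⟨h3, h4⟩ := rd_conj f hf μ hμ hw c h hd hdef l ws hl
  rw [h1, h2, h3, rd_norm_sub_expand w ws c]
  have h5 : ⟪l, w - ws⟫ = - ⟪gradient f ws, w - ws⟫ - 2 * μ * ⟪ws - c, w - ws⟫ := by
    rw [hl]
    simp only [inner_neg_left, inner_add_left, real_inner_smul_left]
    ring
  simp only [inner_neg_left, inner_sub_right] at *
  rw [real_inner_comm l w, real_inner_comm y w]
  linarith

/-- minimizer of the primal `m`-block -/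
theorem rd_xm_grad (f : F → ℝ) (hf : Differentiable ℝ f) (μ : ℝ) (c w y : F)
    (hmin : ∀ u, f w + μ * ‖w - c‖ ^ 2 + ⟪w, y⟫ ≤ f u + μ * ‖u - c‖ ^ 2 + ⟪u, y⟫) :
    y = - (gradient f w + (2 * μ) • (w - c)) := by
  have hg := rd_grad_add (rd_grad_add (hf w).hasGradientAt (rd_grad_normsq c w μ))
    (rd_grad_inner y w)
  have h0 := fun z => rd_firstorder _ _ w z Set.univ convex_univ trivial trivial hg (by
    intro z _
    have := hmin z
    rw [real_inner_comm, real_inner_comm y z] at this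
    exact this)
  have h1 := h0 (w - (gradient f w + (2 * μ) • (w - c) + y))
  rw [sub_sub_cancel_left, inner_neg_right, real_inner_self_eq_norm_sq] at h1
  have h3 : ‖gradient f w + (2 * μ) • (w - c) + y‖ ^ 2 = 0 :=
    le_antisymm (by linarith) (sq_nonneg _)
  have h4 := norm_eq_zero.1 (pow_eq_zero_iff (two_ne_zero) |>.1 h3)
  exact eq_neg_of_add_eq_zero_right h4

/-- parameters -/
theorem rd_params (P μ Lh Abar c α τ η : ℝ) (hP : 1 ≤ P) (hμ : 0 < μ) (hLh : 0 < Lh)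
    (hc : c = Lh * Abar ^ 2 / μ)
    (hα : α = 1 - 2 / (P * (Real.sqrt (1 + 8 * c) + 1)))
    (hτ : τ = α / (1 - α))
    (hη : η = (α - (P - 1) / P) * μ / (1 - α)) :
    0 ≤ α ∧ α < 1 ∧ 0 ≤ τ ∧ 0 ≤ η ∧ τ * (1 - α) = α ∧ (1 + τ) * (1 - α) = 1 ∧
      P * (μ + η) = μ * (1 + τ) ∧ 2 * P * Lh * Abar ^ 2 * (1 - α) = η := by
  have hc0 : 0 ≤ c := by rw [hc]; positivity
  set S := Real.sqrt (1 + 8 * c) with hS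
  have hS2 : S ^ 2 = 1 + 8 * c := Real.sq_sqrt (by linarith)
  have hS1 : 1 ≤ S := by
    rw [hS]; apply Real.le_sqrt_of_sq_le; linarith
  have h1a : 1 - α = 2 / (P * (S + 1)) := by rw [hα]; ring
  have h1pos : 0 < 1 - α := by rw [h1a]; positivity
  have hle : 2 / (P * (S + 1)) ≤ 1 := by
    rw [div_le_one (by positivity)]; nlinarith
  have hα0 : 0 ≤ α := by linarith
  have hτ1 : τ * (1 - α) = α := by rw [hτ]; field_simp
  have hηS : η = μ * (S - 1) / 2 := by
    rw [hη, h1a, hα]; field_simp; ring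
  have h1τ : 1 + τ = P * (S + 1) / 2 := by
    have : 1 + τ = 1 / (1 - α) := by rw [hτ]; field_simp; ring
    rw [this, h1a]; field_simp
  have hτ0 : 0 ≤ τ := by rw [hτ]; positivity
  refine ⟨hα0, by linarith, hτ0, ?_, hτ1, by linarith, ?_, ?_⟩
  · rw [hηS]; have : 0 ≤ S - 1 := by linarith
    positivity
  · rw [h1τ, hηS]; ring
  · rw [h1a, hηS]
    have h8 : Lh * Abar ^ 2 = c * μ := by rw [hc]; field_simp
    have : 2 * P * Lh * Abar ^ 2 * (2 / (P * (S + 1))) = 4 * (Lh * Abar ^ 2) / (S + 1) := by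
      field_simp; ring
    rw [this, h8]
    rw [div_eq_div_iff (by positivity) (by positivity)]
    linear_combination (-μ) * hS2

end helpers

section steps

variable {E Y : Type*} [NormedAddCommGroup E] [InnerProductSpace ℝ E]
  [NormedAddCommGroup Y] [InnerProductSpace ℝ Y]

theorem rd_young (P Lh Abar α τ η a q : ℝ) (hP : 1 ≤ P) (hLh : 0 < Lh) (hα0 : 0 ≤ α) 
    (hα : α < 1) (hτ : τ * (1 - α) = α)
    (h2 : 2 * P * Lh * Abar ^ 2 * (1 - α) = η) :
    P * α * (Abar * a * q) ≤ τ * (1 / Lh / 2 * q ^ 2) + α * (η * P / 2 * a ^ 2) := by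
  have h1 : 0 < 1 - α := by linarith
  have hτe : τ = α / (1 - α) := by field_simp; linarith
  have key : 0 ≤ α / (2 * Lh * (1 - α)) * ((q - P * Lh * Abar * (1 - α) * a) ^ 2
      + (P * Lh * Abar * (1 - α) * a) ^ 2) := by positivity
  have : τ * (1 / Lh / 2 * q ^ 2) + α * (η * P / 2 * a ^ 2) - P * α * (Abar * a * q) =
     α / (2 * Lh * (1 - α)) * ((q - P * Lh * Abar * (1 - α) * a) ^ 2
      + (P * Lh * Abar * (1 - α) * a) ^ 2) := by
    rw [hτe, ← h2]; field_simp; ring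
  linarith

theorem rd_step (P μ Lh Abar α τ η : ℝ) (hP : 1 ≤ P) (hLh : 0 < Lh)
    (hα0 : 0 ≤ α) (hα : α < 1) (hτ0 : 0 ≤ τ) (hτ : τ * (1 - α) = α)
    (hPμ : P * (μ + η) = μ * (1 + τ)) (h2 : 2 * P * Lh * Abar ^ 2 * (1 - α) = η)
    (A : E →L[ℝ] Y) (b : Y) (x0 xm xs xh : E) (yp ym ys : Y)
    (ψh ψs hp hs V1 V0 Vp : ℝ)
    (hx : ψh - ψs + ⟪yp, A (xh - xs)⟫ + η / 2 * ‖xh - x0‖ ^ 2 + (μ + η) / 2 * ‖xh - xs‖ ^ 2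
      ≤ η / 2 * ‖x0 - xs‖ ^ 2)
    (hxs : 0 ≤ ψh - ψs + ⟪ys, A (xh - xs)⟫)
    (hy : hp - hs + ⟪b - A ((P * α) • (x0 - xm) + x0), yp - ys⟫ + τ * V1 + (1 + τ) * Vp ≤ τ * V0)
    (hys : 0 ≤ hp - hs + ⟪b - A xs, yp - ys⟫)
    (hV1 : 1 / Lh / 2 * ‖yp - ym‖ ^ 2 ≤ V1)
    (hA : ‖A (x0 - xm)‖ ≤ Abar * ‖x0 - xm‖) :
    (μ + η) / 2 * (‖xh - xs‖ ^ 2 + (P - 1) * ‖x0 - xs‖ ^ 2) + η / 2 * ‖xh - x0‖ ^ 2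
      + (1 + τ) * Vp + ⟪A (xh - x0), yp - ys⟫
    ≤ α * (P * (μ + η) / 2 * ‖x0 - xs‖ ^ 2 + η * P / 2 * ‖x0 - xm‖ ^ 2 + (1 + τ) * V0
      + P * ⟪A (x0 - xm), ym - ys⟫) := by
  have hyoung := rd_young P Lh Abar α τ η ‖x0 - xm‖ ‖yp - ym‖ hP hLh hα0 hα hτ h2
  have hcs : -⟪A (x0 - xm), yp - ym⟫ ≥ -(Abar * ‖x0 - xm‖ * ‖yp - ym‖) := by
    have h1 := real_inner_le_norm (A (x0 - xm)) (yp - ym)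
    have := mul_le_mul_of_nonneg_right hA (norm_nonneg (yp - ym))
    linarith
  have hcs2 := mul_le_mul_of_nonneg_left hcs (by positivity : 0 ≤ P * α)
  have hV1' := mul_le_mul_of_nonneg_left hV1 hτ0
  have h1 : α * ((1 + τ) * V0) = τ * V0 := by rw [← mul_assoc]; congr 1; linarith
  have h3 : α * (P * (μ + η) / 2 * ‖x0 - xs‖ ^ 2) = (η / 2 + (P - 1) * (μ + η) / 2) * ‖x0 - xs‖ ^ 2 := by
    rw [← mul_assoc]; congr 1
    have : α * (P * (μ + η)) = τ * μ := by rw [hPμ]; linear_combination μ * (-hτ)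
    linear_combination this / 2 - hPμ / 2
  have e1 : ⟪A (xh - x0), yp - ys⟫ = ⟪yp, A (xh - xs)⟫ - ⟪ys, A (xh - xs)⟫
      + ⟪b - A ((P * α) • (x0 - xm) + x0), yp - ys⟫ - ⟪b - A xs, yp - ys⟫
      + P * α * (⟪A (x0 - xm), yp - ym⟫ + ⟪A (x0 - xm), ym - ys⟫) := by
    rw [← real_inner_comm yp, ← real_inner_comm ys]
    simp only [map_add, map_sub, map_smul, inner_sub_left, inner_sub_right, inner_add_left,
      real_inner_smul_left]
    ring
  rw [e1]
  have e2 : ⟪yp, A (xh - xs)⟫ = (ψh - ψs + ⟪yp, A (xh - xs)⟫) - (ψh - ψs) := by ring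
  nlinarith

theorem rd_terminal (P μ Lh Abar α τ η : ℝ) (hP : 1 ≤ P) (hLh : 0 < Lh)
    (hα : α < 1) (hτ : (1 + τ) * (1 - α) = 1)
    (hPμ : P * (μ + η) = μ * (1 + τ)) (h2 : 2 * P * Lh * Abar ^ 2 * (1 - α) = η)
    (u : Y) (a D : ℝ) (y ys : Y) (V : ℝ) (hV : 1 / Lh / 2 * ‖ys - y‖ ^ 2 ≤ V)
    (hA : ‖u‖ ≤ Abar * a) :
    (1 + τ) / 2 * (μ * D + V) ≤ P * (μ + η) / 2 * D + η * P / 2 * a ^ 2 + (1 + τ) * V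
      + P * ⟪u, y - ys⟫ := by
  have h1 : 0 < 1 - α := by linarith
  have hτe : 1 + τ = 1 / (1 - α) := by field_simp; linarith
  have h1τ : 0 < 1 + τ := by rw [hτe]; positivity
  have hcs : -(Abar * a * ‖ys - y‖) ≤ ⟪u, y - ys⟫ := by
    have h1 := abs_real_inner_le_norm u (y - ys)
    have h3 := neg_abs_le ⟪u, y - ys⟫
    have := mul_le_mul_of_nonneg_right hA (norm_nonneg (y - ys))
    rw [norm_sub_rev y ys] at *
    linarith
  have hcs2 := mul_le_mul_of_nonneg_left hcs (by positivity : 0 ≤ P)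
  have hV2 := mul_le_mul_of_nonneg_left hV (by positivity : 0 ≤ (1 + τ) / 2)
  have key : 0 ≤ (1 + τ) / 2 * (1 / Lh / 2 * ‖ys - y‖ ^ 2) + η * P / 2 * a ^ 2 
      - P * (Abar * a * ‖ys - y‖) := by
    have e : (1 + τ) / 2 * (1 / Lh / 2 * ‖ys - y‖ ^ 2) + η * P / 2 * a ^ 2 
      - P * (Abar * a * ‖ys - y‖) = 1 / (4 * Lh * (1 - α)) * 
        (‖ys - y‖ - 2 * P * Lh * Abar * (1 - α) * a) ^ 2 := by
      rw [hτe, ← h2]; field_simp; ring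
    rw [e]; positivity
  have e3 : P * (μ + η) / 2 * D = (1 + τ) / 2 * (μ * D) := by rw [hPμ]; ring
  rw [e3]
  nlinarith

end steps

section blocks

variable {ι : Type*} [Fintype ι] [DecidableEq ι] {E : ι → Type*}
  [∀ i, NormedAddCommGroup (E i)] [∀ i, InnerProductSpace ℝ (E i)] [∀ i, CompleteSpace (E i)]
  {Y : Type*} [NormedAddCommGroup Y] [InnerProductSpace ℝ Y] [CompleteSpace Y]

theorem rd_inner_AA (A : ∀ i, E i →L[ℝ] Y) (AA : PiLp 2 E →L[ℝ] Y) (hAA : ∀ x, AA x = ∑ i, A i (x i))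
    (y : Y) (x : PiLp 2 E) :
    ⟪y, AA x⟫ = ∑ i, ⟪ContinuousLinearMap.adjoint (A i) y, x i⟫ := by
  rw [hAA, inner_sum]
  simp [ContinuousLinearMap.adjoint_inner_left]

theorem rd_single_block (A : ∀ i, E i →L[ℝ] Y) (AA : PiLp 2 E →L[ℝ] Y) (hAA : ∀ x, AA x = ∑ i, A i (x i))
    (Abar : ℝ) (hAbar : Abar = ⨆ i, ‖A i‖) (u : PiLp 2 E) (j : ι) (hu : ∀ i, i ≠ j → u i = 0) :
    ‖AA u‖ ≤ Abar * ‖u‖ := by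
  have h1 : AA u = A j (u j) := by
    rw [hAA]
    apply Finset.sum_eq_single j
    · intro i _ hi; rw [hu i hi, map_zero]
    · simp
  have h2 : ‖u j‖ ≤ ‖u‖ := PiLp.norm_apply_le u j
  have h3 : ‖A j‖ ≤ Abar := by
    rw [hAbar]; exact le_ciSup (f := fun i => ‖A i‖) (Set.finite_range _).bddAbove j
  rw [h1]
  exact ((A j).le_opNorm _).trans (mul_le_mul h3 h2 (norm_nonneg _) ((norm_nonneg _).trans h3))

/-- sums over the possible one-block updates -/
theorem rd_sum_update_sq (x0 xs xh : PiLp 2 E) (x : ι → PiLp 2 E)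
    (hx : ∀ i, x i i = xh i) (hk : ∀ i j, j ≠ i → x i j = x0 j) :
    ∑ i, ‖x i - xs‖ ^ 2 = ‖xh - xs‖ ^ 2 + ((Fintype.card ι : ℝ) - 1) * ‖x0 - xs‖ ^ 2 := by
  have h1 : ∀ i, ‖x i - xs‖ ^ 2 = ‖x0 - xs‖ ^ 2 + (‖xh i - xs i‖ ^ 2 - ‖x0 i - xs i‖ ^ 2) := by
    intro i
    rw [PiLp.norm_sq_eq_of_L2, PiLp.norm_sq_eq_of_L2,
      ← Finset.add_sum_erase _ _ (Finset.mem_univ i),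
      ← Finset.add_sum_erase univ (fun j => ‖(x0 - xs) j‖ ^ 2) (Finset.mem_univ i)]
    have : ∑ j ∈ univ.erase i, ‖(x i - xs) j‖ ^ 2 = ∑ j ∈ univ.erase i, ‖(x0 - xs) j‖ ^ 2 := by
      apply Finset.sum_congr rfl
      intro j hj
      rw [PiLp.sub_apply, PiLp.sub_apply, hk i j (Finset.ne_of_mem_erase hj)]
    rw [this]
    simp only [PiLp.sub_apply, hx]
    ring
  simp_rw [h1]
  rw [Finset.sum_add_distrib, Finset.sum_sub_distrib, PiLp.norm_sq_eq_of_L2 _ (xh - xs)]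
  have : ∑ i, ‖x0 i - xs i‖ ^ 2 = ‖x0 - xs‖ ^ 2 := by
    rw [PiLp.norm_sq_eq_of_L2]; simp
  rw [this]
  simp
  ring

theorem rd_sum_update (x0 xh : PiLp 2 E) (x : ι → PiLp 2 E)
    (hx : ∀ i, x i i = xh i) (hk : ∀ i j, j ≠ i → x i j = x0 j) :
    ∑ i, (x i - x0) = xh - x0 := by
  ext j
  have e : (∑ i, (x i - x0)) j = ∑ i, (x i - x0) j := by
    simp [WithLp.ofLp_sum]
  rw [e, Finset.sum_eq_single j]
  · simp [hx]
  · intro i _ hi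
    simp [hk i j hi.symm]
  · simp

/-- KKT conditions of the subproblem. -/
theorem rd_kkt (f : ∀ i, E i → ℝ) (hf : ∀ i, Differentiable ℝ (f i)) (X : ∀ i, Set (E i))
    (hX : ∀ i, Convex ℝ (X i)) (fm : Y → ℝ) (hfm : Differentiable ℝ fm)
    (A : ∀ i, E i →L[ℝ] Y) (AA : PiLp 2 E →L[ℝ] Y) (hAA : ∀ x, AA x = ∑ i, A i (x i)) (b : Y)
    (μ : ℝ) (xc : PiLp 2 E) (wc : Y) (xs : PiLp 2 E) (ws : Y) (hxs : ∀ i, xs i ∈ X i)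
    (hfeas : AA xs + ws = b)
    (hopt : ∀ (x : PiLp 2 E) (w : Y), (∀ i, x i ∈ X i) → AA x + w = b →
      (∑ i, f i (xs i)) + μ * ‖xs - xc‖ ^ 2 + fm ws + μ * ‖ws - wc‖ ^ 2
        ≤ (∑ i, f i (x i)) + μ * ‖x - xc‖ ^ 2 + fm w + μ * ‖w - wc‖ ^ 2)
    (lam : Y) (hlam : lam = -(gradient fm ws + (2 * μ) • (ws - wc)))
    (x : PiLp 2 E) (hx : ∀ i, x i ∈ X i) :
    0 ≤ ∑ i, ⟪gradient (f i) (xs i) + (2 * μ) • (xs i - xc i)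
      + ContinuousLinearMap.adjoint (A i) lam, x i - xs i⟫ := by
  let v : PiLp 2 E := x - xs
  have hline : ∀ t : ℝ, HasDerivAt (fun t : ℝ => xs + t • v) v t := fun t => by
    simpa using ((hasDerivAt_id t).smul_const v).const_add xs
  have hlineY : ∀ t : ℝ, HasDerivAt (fun t : ℝ => ws - t • AA v) (-(AA v)) t := fun t => by
    simpa using ((hasDerivAt_id t).smul_const (AA v)).const_sub ws
  have hlinei : ∀ i, ∀ t : ℝ, HasDerivAt (fun t : ℝ => xs i + t • v i) (v i) t := fun i t => by
    simpa using ((hasDerivAt_id t).smul_const (v i)).const_add (xs i)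
  have e0 : xs + (0 : ℝ) • v = xs := by simp
  have e0Y : ws - (0 : ℝ) • AA v = ws := by simp
  have e0i : ∀ i, xs i + (0 : ℝ) • v i = xs i := fun i => by rw [zero_smul, add_zero]
  have d1 : HasDerivAt (fun t : ℝ => ∑ i, f i (xs i + t • v i))
      (∑ i, ⟪gradient (f i) (xs i), v i⟫) 0 := by
    apply HasDerivAt.fun_sum
    intro i _
    have h1 : HasFDerivAt (f i) (InnerProductSpace.toDual ℝ (E i) (gradient (f i) (xs i))) (xs i + (0 : ℝ) • v i) := by
      rw [e0i]; exact (hf i (xs i)).hasGradientAt.hasFDerivAt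
    have := h1.comp_hasDerivAt 0 (hlinei i 0)
    exact this.congr_deriv (InnerProductSpace.toDual_apply_apply)
  have d2 : HasDerivAt (fun t : ℝ => μ * ‖xs + t • v - xc‖ ^ 2) (2 * μ * ⟪xs - xc, v⟫) 0 := by
    have h1 := (((hline 0).sub_const xc).norm_sq).const_mul μ
    rw [e0] at h1
    refine h1.congr_deriv (by ring)
  have d3 : HasDerivAt (fun t : ℝ => fm (ws - t • AA v)) (-⟪gradient fm ws, AA v⟫) 0 := by
    have h1 : HasFDerivAt fm (InnerProductSpace.toDual ℝ Y (gradient fm ws)) (ws - (0 : ℝ) • AA v) := by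
      rw [e0Y]; exact (hfm ws).hasGradientAt.hasFDerivAt
    have := h1.comp_hasDerivAt 0 (hlineY 0)
    refine this.congr_deriv ?_
    rw [map_neg, InnerProductSpace.toDual_apply_apply]
  have d4 : HasDerivAt (fun t : ℝ => μ * ‖ws - t • AA v - wc‖ ^ 2)
      (-(2 * μ * ⟪ws - wc, AA v⟫)) 0 := by
    have h1 := (((hlineY 0).sub_const wc).norm_sq).const_mul μ
    rw [e0Y] at h1
    refine h1.congr_deriv ?_
    rw [inner_neg_right]; ring
  have d := ((d1.fun_add d2).fun_add d3).fun_add d4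
  let Q : ℝ → ℝ := fun t => (∑ i, f i (xs i + t • v i)) + μ * ‖xs + t • v - xc‖ ^ 2
    + fm (ws - t • AA v) + μ * ‖ws - t • AA v - wc‖ ^ 2
  have hmin : ∀ t ∈ Set.Icc (0 : ℝ) 1, Q 0 ≤ Q t := by
    intro t ht
    have := hopt (xs + t • v) (ws - t • AA v) (by
      intro i
      have : (xs + t • v) i = xs i + t • (x i - xs i) := by simp [v]
      rw [this]
      exact (hX i).add_smul_sub_mem (hxs i) (hx i) ht) (by
      rw [map_add, map_smul, ← hfeas]; abel)
    simpa [Q] using this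
  have hloc : IsLocalMinOn Q (Set.Icc (0 : ℝ) 1) 0 := IsMinOn.localize (fun t ht => hmin t ht)
  have hfin := hloc.hasFDerivWithinAt_nonneg d.hasFDerivAt.hasFDerivWithinAt
    (y := 1) (by
      have := sub_mem_posTangentConeAt_of_segment_subset (x := (0 : ℝ)) (y := 1)
        (s := Set.Icc (0 : ℝ) 1) (by rw [segment_eq_Icc zero_le_one])
      simpa using this)
  have hfin2 : 0 ≤ (∑ i, ⟪gradient (f i) (xs i), v i⟫) + 2 * μ * ⟪xs - xc, v⟫
      - ⟪gradient fm ws, AA v⟫ - 2 * μ * ⟪ws - wc, AA v⟫ := by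
    rw [ContinuousLinearMap.toSpanSingleton_apply, one_smul] at hfin
    linarith
  have e1 : ⟪lam, AA v⟫ = - ⟪gradient fm ws, AA v⟫ - 2 * μ * ⟪ws - wc, AA v⟫ := by
    rw [hlam, inner_neg_left, inner_add_left, real_inner_smul_left]; ring
  rw [rd_inner_AA A AA hAA lam v] at e1
  have e2 : 2 * μ * ⟪xs - xc, v⟫ = ∑ i, 2 * μ * ⟪xs i - xc i, v i⟫ := by
    rw [PiLp.inner_apply, Finset.mul_sum]; simp
  rw [e2] at hfin2
  have : ∑ i, ⟪gradient (f i) (xs i) + (2 * μ) • (xs i - xc i)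
      + ContinuousLinearMap.adjoint (A i) lam, x i - xs i⟫ = 
      (∑ i, ⟪gradient (f i) (xs i), v i⟫) + (∑ i, 2 * μ * ⟪xs i - xc i, v i⟫) + 
      ∑ i, ⟪ContinuousLinearMap.adjoint (A i) lam, v i⟫ := by
    rw [← Finset.sum_add_distrib, ← Finset.sum_add_distrib]
    apply Finset.sum_congr rfl
    intro i _
    simp only [v, inner_add_left, real_inner_smul_left, PiLp.sub_apply]
  rw [this, e1]
  linarith

end blocks

section avg

theorem rd_avg {k s : ℕ} {J : Type*} [Fintype J] [DecidableEq J] (l : Fin k) (t : Fin s)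
    (g : (Fin k → Fin s → J) → ℝ) :
    ∑ ω : Fin k → Fin s → J, ∑ i, g (Function.update ω l (Function.update (ω l) t i))
      = (Fintype.card J : ℝ) * ∑ ω : Fin k → Fin s → J, g ω := by
  let φ : ((Fin k → Fin s → J) × J) → ((Fin k → Fin s → J) × J) := fun p =>
    (Function.update p.1 l (Function.update (p.1 l) t p.2), p.1 l t)
  have hφ : Function.Involutive φ := by
    rintro ⟨ω, i⟩
    simp [φ]
  have h1 : ∑ p : (Fin k → Fin s → J) × J, g (φ p).1 = ∑ p : (Fin k → Fin s → J) × J, g p.1 :=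
    Equiv.sum_comp (hφ.toPerm) (fun p => g p.1)
  rw [Fintype.sum_prod_type, Fintype.sum_prod_type] at h1
  simp [φ] at h1
  rw [h1, Finset.mul_sum]

end avg

section sub

variable {ι : Type*} [Fintype ι] [DecidableEq ι] {E : ι → Type*}
  [∀ i, NormedAddCommGroup (E i)] [∀ i, InnerProductSpace ℝ (E i)] [∀ i, CompleteSpace (E i)]
  {Y : Type*} [NormedAddCommGroup Y] [InnerProductSpace ℝ Y] [CompleteSpace Y]

theorem rd_sub_strong (f : ∀ i, E i → ℝ) (X : ∀ i, Set (E i)) (μ : ℝ)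
    (hw : ∀ i, ∀ x ∈ X i, ∀ y ∈ X i,
      f i x - f i y - ⟪gradient (f i) y, x - y⟫ ≥ -(μ / 2) * ‖x - y‖ ^ 2)
    (A : ∀ i, E i →L[ℝ] Y) (AA : PiLp 2 E →L[ℝ] Y) (hAA : ∀ x, AA x = ∑ i, A i (x i))
    (xc xs : PiLp 2 E) (hxs : ∀ i, xs i ∈ X i) (lam : Y)
    (hkkt : ∀ x : PiLp 2 E, (∀ i, x i ∈ X i) →
      0 ≤ ∑ i, ⟪gradient (f i) (xs i) + (2 * μ) • (xs i - xc i)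
      + ContinuousLinearMap.adjoint (A i) lam, x i - xs i⟫)
    (x : PiLp 2 E) (hx : ∀ i, x i ∈ X i) :
    μ / 2 * ‖x - xs‖ ^ 2 ≤ ((∑ i, f i (x i)) + μ * ‖x - xc‖ ^ 2)
      - ((∑ i, f i (xs i)) + μ * ‖xs - xc‖ ^ 2) + ⟪lam, AA (x - xs)⟫ := by
  have h1 := hkkt x hx
  have h2 : ∑ i, (μ / 2 * ‖x i - xs i‖ ^ 2 + ⟪gradient (f i) (xs i) + (2 * μ) • (xs i - xc i)
      + ContinuousLinearMap.adjoint (A i) lam, x i - xs i⟫) ≤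
      ∑ i, (f i (x i) + μ * ‖x i - xc i‖ ^ 2 - (f i (xs i) + μ * ‖xs i - xc i‖ ^ 2)
       + ⟪ContinuousLinearMap.adjoint (A i) lam, x i - xs i⟫) := by
    apply Finset.sum_le_sum
    intro i _
    have h3 := hw i (x i) (hx i) (xs i) (hxs i)
    rw [rd_norm_sub_expand (x i) (xs i) (xc i), inner_add_left, inner_add_left,
      real_inner_smul_left]
    linarith
  rw [rd_inner_AA A AA hAA, PiLp.norm_sq_eq_of_L2, PiLp.norm_sq_eq_of_L2,
    PiLp.norm_sq_eq_of_L2]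
  simp only [PiLp.sub_apply]
  simp only [Finset.sum_add_distrib, Finset.sum_sub_distrib, ← Finset.mul_sum] at h2 ⊢
  linarith

theorem rd_sub_unique (f : ∀ i, E i → ℝ) (hf : ∀ i, Differentiable ℝ (f i)) (X : ∀ i, Set (E i))
    (hX : ∀ i, Convex ℝ (X i)) (μ : ℝ) (hμ : 0 < μ)
    (hw : ∀ i, ∀ x ∈ X i, ∀ y ∈ X i,
      f i x - f i y - ⟪gradient (f i) y, x - y⟫ ≥ -(μ / 2) * ‖x - y‖ ^ 2)
    (fm : Y → ℝ) (hfm : Differentiable ℝ fm)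
    (hwm : ∀ x y, fm x - fm y - ⟪gradient fm y, x - y⟫ ≥ -(μ / 2) * ‖x - y‖ ^ 2)
    (A : ∀ i, E i →L[ℝ] Y) (AA : PiLp 2 E →L[ℝ] Y) (hAA : ∀ x, AA x = ∑ i, A i (x i)) (b : Y)
    (xc : PiLp 2 E) (wc : Y) (xs : PiLp 2 E) (ws : Y) (hxs : ∀ i, xs i ∈ X i)
    (hfeas : AA xs + ws = b)
    (hopt : ∀ (x : PiLp 2 E) (w : Y), (∀ i, x i ∈ X i) → AA x + w = b →
      (∑ i, f i (xs i)) + μ * ‖xs - xc‖ ^ 2 + fm ws + μ * ‖ws - wc‖ ^ 2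
        ≤ (∑ i, f i (x i)) + μ * ‖x - xc‖ ^ 2 + fm w + μ * ‖w - wc‖ ^ 2)
    (xs' : PiLp 2 E) (ws' : Y) (hxs' : ∀ i, xs' i ∈ X i)
    (hfeas' : AA xs' + ws' = b)
    (hopt' : ∀ (x : PiLp 2 E) (w : Y), (∀ i, x i ∈ X i) → AA x + w = b →
      (∑ i, f i (xs' i)) + μ * ‖xs' - xc‖ ^ 2 + fm ws' + μ * ‖ws' - wc‖ ^ 2
        ≤ (∑ i, f i (x i)) + μ * ‖x - xc‖ ^ 2 + fm w + μ * ‖w - wc‖ ^ 2) :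
    xs = xs' ∧ ws = ws' := by
  have hk := rd_kkt f hf X hX fm hfm A AA hAA b μ xc wc xs ws hxs hfeas hopt _ rfl
  have h1 := rd_sub_strong f X μ hw A AA hAA xc xs hxs _ hk xs' hxs'
  have h2 := hopt' xs ws hxs hfeas
  have h3 := hwm ws' ws
  have e := rd_norm_sub_expand ws' ws wc
  have e2 : AA (xs' - xs) = -(ws' - ws) := by
    rw [map_sub, eq_sub_of_add_eq hfeas, eq_sub_of_add_eq hfeas']; abel
  rw [e2, inner_neg_neg, inner_add_left, real_inner_smul_left] at h1
  have h5 : μ / 2 * ‖xs' - xs‖ ^ 2 ≤ 0 := by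
    have : 0 ≤ μ / 2 * ‖ws' - ws‖ ^ 2 := by positivity
    rw [e] at h2
    nlinarith
  have h4 : ‖xs' - xs‖ ^ 2 ≤ 0 := by
    by_contra hcon
    push Not at hcon
    have : 0 < μ / 2 * ‖xs' - xs‖ ^ 2 := by positivity
    linarith
  have h6 : ‖xs' - xs‖ = 0 :=
    pow_eq_zero_iff (two_ne_zero) |>.1 (le_antisymm h4 (sq_nonneg _))
  have h7 := (sub_eq_zero.1 (norm_eq_zero.1 h6)).symm
  refine ⟨h7, ?_⟩
  rw [← h7] at hfeas'
  exact add_left_cancel (hfeas.trans hfeas'.symm)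

end sub

theorem rd_outer_sum (k : ℕ) (a φ : Fin (k + 1) → ℝ) (μ C : ℝ)
    (h0 : φ 0 + μ * a 0 ≤ C)
    (hstep : ∀ j (hj : j + 1 < k + 1),
      φ ⟨j + 1, hj⟩ + μ * a ⟨j + 1, hj⟩ ≤ φ ⟨j, by omega⟩ + μ / 2 * a ⟨j, by omega⟩) :
    μ / 2 * ∑ l, a l + μ / 2 * a (Fin.last k) + φ (Fin.last k) ≤ C := by
  induction k with
  | zero => simp at *; linarith
  | succ k ih =>
    have h1 := ih (fun l => a l.castSucc) (fun l => φ l.castSucc) (by simpa using h0)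
      (fun j hj => hstep j (by omega))
    rw [Fin.sum_univ_castSucc]
    have h2 := hstep k (by omega)
    have e1 : (⟨k + 1, by omega⟩ : Fin (k + 1 + 1)) = Fin.last (k + 1) := rfl
    have e2 : (⟨k, by omega⟩ : Fin (k + 1 + 1)) = (Fin.last k).castSucc := rfl
    rw [e1, e2] at h2
    linarith

theorem rd_outer (k : ℕ) (hk : 1 ≤ k) (a φ : Fin k → ℝ) (μ C C' : ℝ) (hμ : 0 < μ)
    (ha : ∀ l, 0 ≤ a l) (hφ : ∀ l, C' ≤ φ l)
    (h0 : φ ⟨0, hk⟩ + μ * a ⟨0, hk⟩ ≤ C)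
    (hstep : ∀ j (hj : j + 1 < k),
      φ ⟨j + 1, hj⟩ + μ * a ⟨j + 1, hj⟩ ≤ φ ⟨j, by omega⟩ + μ / 2 * a ⟨j, by omega⟩) :
    μ / 2 * ∑ l, a l ≤ C - C' := by
  obtain ⟨k, rfl⟩ : ∃ k', k = k' + 1 := ⟨k - 1, by omega⟩
  have h1 := rd_outer_sum k a φ μ C h0 hstep
  have h2 := ha (Fin.last k)
  have h3 := hφ (Fin.last k)
  have : 0 ≤ μ / 2 * a (Fin.last k) := by positivity
  linarith

set_option maxHeartbeats 4000000 in
/-- Theorem 3 (main convergence of RapDual). -/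
theorem stmt10 (m n k s : ℕ) (hm : 2 ≤ m) (hn : 0 < n) (hk : 1 ≤ k) (hs : 1 ≤ s)
    (d : Fin (m - 1) → ℕ) (hd : ∀ i, 0 < d i)
    (Xi : ∀ i : Fin (m - 1), Set (EuclideanSpace ℝ (Fin (d i))))
    (hXne : ∀ i, (Xi i).Nonempty) (hXcl : ∀ i, IsClosed (Xi i))
    (hXcv : ∀ i, Convex ℝ (Xi i))
    (μ L : ℝ) (hμ : 0 < μ) (hμL : μ ≤ L)
    (f : ∀ i : Fin (m - 1), EuclideanSpace ℝ (Fin (d i)) → ℝ)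
    (hfd : ∀ i, Differentiable ℝ (f i))
    (hfw : ∀ i, ∀ x ∈ Xi i, ∀ y ∈ Xi i,
      f i x - f i y - ⟪gradient (f i) y, x - y⟫ ≥ -(μ / 2) * ‖x - y‖ ^ 2)
    (fm : EuclideanSpace ℝ (Fin n) → ℝ) (hfmd : Differentiable ℝ fm)
    (hfmLip : ∀ x y : EuclideanSpace ℝ (Fin n),
      ‖gradient fm x - gradient fm y‖ ≤ L * ‖x - y‖)
    (hfmw : ∀ x y : EuclideanSpace ℝ (Fin n),
      fm x - fm y - ⟪gradient fm y, x - y⟫ ≥ -(μ / 2) * ‖x - y‖ ^ 2)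
    (A : ∀ i : Fin (m - 1), EuclideanSpace ℝ (Fin (d i)) →L[ℝ] EuclideanSpace ℝ (Fin n))
    (b : EuclideanSpace ℝ (Fin n))
    (Abar : ℝ) (hAbar : Abar = ⨆ i, ‖A i‖)
    -- the full coupling map `𝐀 : E →L Y`, `𝐀x = Σᵢ Aᵢxᵢ`
    (AA : (PiLp 2 fun i : Fin (m - 1) => EuclideanSpace ℝ (Fin (d i))) →L[ℝ]
      EuclideanSpace ℝ (Fin n))
    (hAA : ∀ x, AA x = ∑ i, A i (x i))
    -- optimal solution of the original problem
    (xopt : PiLp 2 fun i : Fin (m - 1) => EuclideanSpace ℝ (Fin (d i)))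
    (xmopt : EuclideanSpace ℝ (Fin n))
    (hxoptX : ∀ i, xopt i ∈ Xi i) (hxoptfeas : AA xopt + xmopt = b)
    (hxopt : ∀ (x : PiLp 2 fun i : Fin (m - 1) => EuclideanSpace ℝ (Fin (d i)))
        (w : EuclideanSpace ℝ (Fin n)), (∀ i, x i ∈ Xi i) → AA x + w = b →
      (∑ i, f i (xopt i)) + fm xmopt ≤ (∑ i, f i (x i)) + fm w)
    -- parameters
    (Lh μbar c α τc ηc : ℝ)
    (hLh : Lh = L + 2 * μ) (hμbar : μbar = 1 / Lh) (hcdef : c = Lh * Abar ^ 2 / μ)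
    (hα : α = 1 - 2 / (((m : ℝ) - 1) * (Real.sqrt (1 + 8 * c) + 1)))
    (hτ : τc = α / (1 - α))
    (hη : ηc = (α - ((m : ℝ) - 2) / ((m : ℝ) - 1)) * μ / (1 - α))
    -- outer sequences of RapDual
    (xbar0 : PiLp 2 fun i : Fin (m - 1) => EuclideanSpace ℝ (Fin (d i)))
    (xmbar0 : EuclideanSpace ℝ (Fin n))
    (hxbar0X : ∀ i, xbar0 i ∈ Xi i) (hfeas0 : AA xbar0 + xmbar0 = b)
    (xbar : (Fin k → Fin s → Fin (m - 1)) → ℕ →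
      PiLp 2 fun i : Fin (m - 1) => EuclideanSpace ℝ (Fin (d i)))
    (xmbar : (Fin k → Fin s → Fin (m - 1)) → ℕ → EuclideanSpace ℝ (Fin n))
    (hxbarinit : ∀ ω, xbar ω 0 = xbar0)
    (hxmbarinit : ∀ ω, xmbar ω 0 = xmbar0)
    -- the dual functions `h^ℓ(y) = (ψ_m^ℓ)^*(−y)` of the subproblems
    (hF : (Fin k → Fin s → Fin (m - 1)) → Fin k →
      EuclideanSpace ℝ (Fin n) → ℝ)
    (hhFdef : ∀ ω ℓ y, hF ω ℓ y =
      ⨆ w : EuclideanSpace ℝ (Fin n),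
        (⟪-y, w⟫ - (fm w + μ * ‖w - xmbar ω ℓ.1‖ ^ 2)))
    (hhFd : ∀ ω ℓ, Differentiable ℝ (hF ω ℓ))
    (hhFsc : ∀ ω ℓ y y', hF ω ℓ y - hF ω ℓ y' - ⟪gradient (hF ω ℓ) y', y - y'⟫
      ≥ (1 / Lh) / 2 * ‖y - y'‖ ^ 2)
    -- inner RaDual iterates for the `ℓ`-th subproblem (`ℓ : Fin k` encodes outer
    -- iteration `ℓ+1`, prox centers `x̄^ℓ = xbar ω ℓ.1`, `x̄_m^ℓ = xmbar ω ℓ.1`)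
    (xx : (Fin k → Fin s → Fin (m - 1)) → Fin k → ℕ →
      PiLp 2 fun i : Fin (m - 1) => EuclideanSpace ℝ (Fin (d i)))
    (yy : (Fin k → Fin s → Fin (m - 1)) → Fin k → ℕ → EuclideanSpace ℝ (Fin n))
    (hxx0 : ∀ ω ℓ, xx ω ℓ 0 = xbar ω ℓ.1)
    (hyy0 : ∀ ω ℓ, yy ω ℓ 0 =
      -gradient (fun w => fm w + μ * ‖w - xmbar ω ℓ.1‖ ^ 2) (xmbar ω ℓ.1))
    -- `yᵗ = argmin_y { h^ℓ(y) + ⟨b − 𝐀x̃ᵗ, y⟩ + τ_t V_{h^ℓ}(y, yᵗ⁻¹) }`,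
    -- with `x̃ᵗ = α_t(xᵗ⁻¹ − xᵗ⁻²) + xᵗ⁻¹`, `α_t = (m−1)α`, `x⁻¹ = x⁰`
    (hyymin : ∀ ω (ℓ : Fin k) (t : Fin s), ∀ y : EuclideanSpace ℝ (Fin n),
      hF ω ℓ (yy ω ℓ (t.1 + 1))
          + ⟪b - AA ((((m : ℝ) - 1) * α) • (xx ω ℓ t.1 - xx ω ℓ (t.1 - 1)) + xx ω ℓ t.1),
              yy ω ℓ (t.1 + 1)⟫
          + τc * breg (hF ω ℓ) (yy ω ℓ (t.1 + 1)) (yy ω ℓ t.1)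
        ≤ hF ω ℓ y
          + ⟪b - AA ((((m : ℝ) - 1) * α) • (xx ω ℓ t.1 - xx ω ℓ (t.1 - 1)) + xx ω ℓ t.1), y⟫
          + τc * breg (hF ω ℓ) y (yy ω ℓ t.1))
    -- only the randomly selected block is updated, via the prox-step on
    -- `ψᵢ^ℓ(z) = fᵢ(z) + μ‖z − x̄ᵢ^{ℓ−1}‖²`
    (hxkeep : ∀ ω (ℓ : Fin k) (t : Fin s) (i : Fin (m - 1)),
      i ≠ ω ℓ t → xx ω ℓ (t.1 + 1) i = xx ω ℓ t.1 i)
    (hxmem : ∀ ω (ℓ : Fin k) (t : Fin s), xx ω ℓ (t.1 + 1) (ω ℓ t) ∈ Xi (ω ℓ t))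
    (hxmin : ∀ (ω : Fin k → Fin s → Fin (m - 1)) (ℓ : Fin k) (t : Fin s),
      ∀ z ∈ Xi (ω ℓ t),
      f (ω ℓ t) (xx ω ℓ (t.1 + 1) (ω ℓ t))
          + μ * ‖xx ω ℓ (t.1 + 1) (ω ℓ t) - xbar ω ℓ.1 (ω ℓ t)‖ ^ 2
          + ⟪ContinuousLinearMap.adjoint (A (ω ℓ t)) (yy ω ℓ (t.1 + 1)),
              xx ω ℓ (t.1 + 1) (ω ℓ t)⟫
          + ηc / 2 * ‖xx ω ℓ (t.1 + 1) (ω ℓ t) - xx ω ℓ t.1 (ω ℓ t)‖ ^ 2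
        ≤ f (ω ℓ t) z + μ * ‖z - xbar ω ℓ.1 (ω ℓ t)‖ ^ 2
          + ⟪ContinuousLinearMap.adjoint (A (ω ℓ t)) (yy ω ℓ (t.1 + 1)), z⟫
          + ηc / 2 * ‖z - xx ω ℓ t.1 (ω ℓ t)‖ ^ 2)
    -- outer updates: `x̄^ℓ = xˢ` and `x̄_m^ℓ = argmin_w {ψ_m^ℓ(w) + ⟨w, yˢ⟩}`
    (hxbarsucc : ∀ ω (ℓ : Fin k), xbar ω (ℓ.1 + 1) = xx ω ℓ s)
    (hxmbarsucc : ∀ ω (ℓ : Fin k), ∀ w : EuclideanSpace ℝ (Fin n),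
      fm (xmbar ω (ℓ.1 + 1)) + μ * ‖xmbar ω (ℓ.1 + 1) - xmbar ω ℓ.1‖ ^ 2
          + ⟪xmbar ω (ℓ.1 + 1), yy ω ℓ s⟫
        ≤ fm w + μ * ‖w - xmbar ω ℓ.1‖ ^ 2 + ⟪w, yy ω ℓ s⟫)
    -- `(x_*^{ℓ+1}, x_{m*}^{ℓ+1})` is the optimal solution of the `ℓ+1`-st subproblem
    (xstar : (Fin k → Fin s → Fin (m - 1)) → Fin k →
      PiLp 2 fun i : Fin (m - 1) => EuclideanSpace ℝ (Fin (d i)))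
    (xmstar : (Fin k → Fin s → Fin (m - 1)) → Fin k → EuclideanSpace ℝ (Fin n))
    (hxstarX : ∀ ω ℓ i, xstar ω ℓ i ∈ Xi i)
    (hxstarfeas : ∀ ω ℓ, AA (xstar ω ℓ) + xmstar ω ℓ = b)
    (hxstaropt : ∀ ω (ℓ : Fin k),
      ∀ (x : PiLp 2 fun i : Fin (m - 1) => EuclideanSpace ℝ (Fin (d i)))
        (w : EuclideanSpace ℝ (Fin n)), (∀ i, x i ∈ Xi i) → AA x + w = b →
      (∑ i, f i (xstar ω ℓ i)) + μ * ‖xstar ω ℓ - xbar ω ℓ.1‖ ^ 2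
          + fm (xmstar ω ℓ) + μ * ‖xmstar ω ℓ - xmbar ω ℓ.1‖ ^ 2
        ≤ (∑ i, f i (x i)) + μ * ‖x - xbar ω ℓ.1‖ ^ 2
          + fm w + μ * ‖w - xmbar ω ℓ.1‖ ^ 2)
    -- the Lagrange multiplier `λ^{ℓ+1} = −∇ψ_m^{ℓ+1}(x_{m*}^{ℓ+1})`
    (lam : (Fin k → Fin s → Fin (m - 1)) → Fin k → EuclideanSpace ℝ (Fin n))
    (hlam : ∀ ω ℓ, lam ω ℓ =
      -gradient (fun w => fm w + μ * ‖w - xmbar ω ℓ.1‖ ^ 2) (xmstar ω ℓ))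
    -- condition on the number of inner iterations
    (hsM : (4 + 2 * L / μ) * α ^ s ≤ min (1 / 2) (μ ^ 2 / L ^ 2)) :
    -- conclusions of Theorem 3 (the expectation is over `ω` and the uniformly
    -- chosen `ℓ : Fin k`, encoding `ℓ̂ = ℓ+1`)
    ((k : ℝ)⁻¹ * ∑ ℓ : Fin k,
        (Fintype.card (Fin k → Fin s → Fin (m - 1)) : ℝ)⁻¹ *
          ∑ ω : Fin k → Fin s → Fin (m - 1),
            (Metric.infDist
              ((WithLp.equiv 2 (∀ i : Fin (m - 1), EuclideanSpace ℝ (Fin (d i)))).symm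
                (fun i => gradient (f i) (xstar ω ℓ i)
                  + ContinuousLinearMap.adjoint (A i) (lam ω ℓ)))
              {v : PiLp 2 fun i : Fin (m - 1) => EuclideanSpace ℝ (Fin (d i)) |
                ∀ yx, (∀ i, yx i ∈ Xi i) → ⟪-v, yx - xstar ω ℓ⟫ ≤ 0}) ^ 2
      ≤ 8 * μ / k *
          ((∑ i, f i (xbar0 i)) + fm xmbar0 - (∑ i, f i (xopt i)) - fm xmopt)) ∧
    ((k : ℝ)⁻¹ * ∑ ℓ : Fin k,
        (Fintype.card (Fin k → Fin s → Fin (m - 1)) : ℝ)⁻¹ *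
          ∑ ω : Fin k → Fin s → Fin (m - 1),
            ‖gradient fm (xmbar ω (ℓ.1 + 1)) + lam ω ℓ‖ ^ 2
      ≤ 34 * μ / k *
          ((∑ i, f i (xbar0 i)) + fm xmbar0 - (∑ i, f i (xopt i)) - fm xmopt)) ∧
    ((k : ℝ)⁻¹ * ∑ ℓ : Fin k,
        (Fintype.card (Fin k → Fin s → Fin (m - 1)) : ℝ)⁻¹ *
          ∑ ω : Fin k → Fin s → Fin (m - 1),
            ‖xbar ω (ℓ.1 + 1) - xstar ω ℓ‖ ^ 2
      ≤ 2 * μ / (k * L ^ 2) *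
          ((∑ i, f i (xbar0 i)) + fm xmbar0 - (∑ i, f i (xopt i)) - fm xmopt)) ∧
    ((k : ℝ)⁻¹ * ∑ ℓ : Fin k,
        (Fintype.card (Fin k → Fin s → Fin (m - 1)) : ℝ)⁻¹ *
          ∑ ω : Fin k → Fin s → Fin (m - 1),
            ‖AA (xbar ω (ℓ.1 + 1)) + xmbar ω (ℓ.1 + 1) - b‖ ^ 2
      ≤ 2 * (‖AA‖ ^ 2 + 1) * μ / (k * L ^ 2) *
          ((∑ i, f i (xbar0 i)) + fm xmbar0 - (∑ i, f i (xopt i)) - fm xmopt)) := by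
  classical
  -- parameters
  have hm1 : 1 ≤ m := by omega
  have hm2 : (2 : ℝ) ≤ m := by exact_mod_cast hm
  obtain ⟨P, hPdef⟩ : ∃ P : ℝ, P = (m : ℝ) - 1 := ⟨_, rfl⟩
  have hP1 : 1 ≤ P := by linarith
  have hcardP : (Fintype.card (Fin (m - 1)) : ℝ) = P := by
    rw [Fintype.card_fin, Nat.cast_sub hm1, hPdef]; simp
  have hL : 0 < L := by linarith
  have hLh0 : 0 < Lh := by rw [hLh]; linarith
  rw [← hPdef] at hα
  have hη' : ηc = (α - (P - 1) / P) * μ / (1 - α) := by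
    rw [hη, hPdef]; congr 4; ring
  simp only [← hPdef] at hyymin
  obtain ⟨hα0, hα1, hτ0, hη0, hτα, h1τ, hPμ, h2P⟩ :=
    rd_params P μ Lh Abar c α τc ηc hP1 hμ hLh0 hcdef hα hτ hη'
  -- membership
  have hmemxx : ∀ ω (ℓ : Fin k), (∀ i, xbar ω ℓ.1 i ∈ Xi i) → ∀ t, t ≤ s → ∀ i,
      xx ω ℓ t i ∈ Xi i := by
    intro ω ℓ h0 t
    induction t with
    | zero => intro _ i; rw [hxx0]; exact h0 i
    | succ t ih =>
      intro ht i
      by_cases hi : i = ω ℓ ⟨t, ht⟩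
      · rw [hi]; exact hxmem ω ℓ ⟨t, ht⟩
      · have := hxkeep ω ℓ ⟨t, ht⟩ i hi
        rw [this]; exact ih (by omega) i
  have hmembar : ∀ ω l, l ≤ k → ∀ i, xbar ω l i ∈ Xi i := by
    intro ω l
    induction l with
    | zero => intro _ i; rw [hxbarinit]; exact hxbar0X i
    | succ l ih =>
      intro hl i
      have := hxbarsucc ω ⟨l, hl⟩
      simp only at this
      rw [this]
      exact hmemxx ω ⟨l, hl⟩ (ih (by omega)) s le_rfl i
  have hmemx : ∀ ω (ℓ : Fin k) t, t ≤ s → ∀ i, xx ω ℓ t i ∈ Xi i := fun ω ℓ =>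
    hmemxx ω ℓ (hmembar ω ℓ.1 ℓ.2.le)
  -- the multipliers
  have hlam' : ∀ ω ℓ, lam ω ℓ = -(gradient fm (xmstar ω ℓ)
      + (2 * μ) • (xmstar ω ℓ - xmbar ω ℓ.1)) := by
    intro ω ℓ; rw [hlam, rd_grad_prox fm hfmd]
  have hyy0' : ∀ ω (ℓ : Fin k), yy ω ℓ 0 = -(gradient fm (xmbar ω ℓ.1)
      + (2 * μ) • (xmbar ω ℓ.1 - xmbar ω ℓ.1)) := by
    intro ω ℓ; rw [hyy0, rd_grad_prox fm hfmd]
  have hyys : ∀ ω (ℓ : Fin k), yy ω ℓ s = -(gradient fm (xmbar ω (ℓ.1 + 1))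
      + (2 * μ) • (xmbar ω (ℓ.1 + 1) - xmbar ω ℓ.1)) := by
    intro ω ℓ; exact rd_xm_grad fm hfmd μ _ _ _ (hxmbarsucc ω ℓ)
  have hkkt : ∀ ω ℓ, ∀ x : PiLp 2 fun i : Fin (m - 1) => EuclideanSpace ℝ (Fin (d i)),
      (∀ i, x i ∈ Xi i) →
      0 ≤ ∑ i, ⟪gradient (f i) (xstar ω ℓ i) + (2 * μ) • (xstar ω ℓ i - xbar ω ℓ.1 i)
      + ContinuousLinearMap.adjoint (A i) (lam ω ℓ), x i - xstar ω ℓ i⟫ := by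
    intro ω ℓ
    exact rd_kkt f hfd Xi hXcv fm hfmd A AA hAA b μ _ _ _ _ (hxstarX ω ℓ) (hxstarfeas ω ℓ)
      (hxstaropt ω ℓ) _ (hlam' ω ℓ)
  have hstrong := fun ω ℓ => rd_sub_strong f Xi μ hfw A AA hAA _ _ (hxstarX ω ℓ) _ (hkkt ω ℓ)
  -- causality
  have hLh2 : 0 < 1 / Lh / 2 := by positivity
  have hcausF : ∀ ω ω' (ℓ : Fin k), xmbar ω ℓ.1 = xmbar ω' ℓ.1 → hF ω ℓ = hF ω' ℓ := by
    intro ω ω' ℓ h; funext y; rw [hhFdef, hhFdef, h]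
  have hcausY : ∀ ω ω' (ℓ : Fin k) (t : Fin s), xmbar ω ℓ.1 = xmbar ω' ℓ.1 →
      xx ω ℓ t.1 = xx ω' ℓ t.1 → xx ω ℓ (t.1 - 1) = xx ω' ℓ (t.1 - 1) →
      yy ω ℓ t.1 = yy ω' ℓ t.1 → yy ω ℓ (t.1 + 1) = yy ω' ℓ (t.1 + 1) := by
    intro ω ω' ℓ t h1 h2 h3 h4
    have e1 := hyymin ω ℓ t
    have e2 := hyymin ω' ℓ t
    simp only [breg] at e1 e2
    rw [← hcausF ω ω' ℓ h1, ← h2, ← h3, ← h4] at e2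
    exact rd_dual_unique (hF ω ℓ) (hhFd ω ℓ) τc (1 / Lh / 2) hτ0 hLh2 (hhFsc ω ℓ) _ _ _ _ e1 e2
  have hcausI : ∀ ω ω' (ℓ : Fin k), xbar ω ℓ.1 = xbar ω' ℓ.1 → xmbar ω ℓ.1 = xmbar ω' ℓ.1 →
      ∀ t, t ≤ s → (∀ t' : Fin s, t'.1 < t → ω ℓ t' = ω' ℓ t') →
      ∀ t', t' ≤ t → xx ω ℓ t' = xx ω' ℓ t' ∧ yy ω ℓ t' = yy ω' ℓ t' := by
    intro ω ω' ℓ h1 h2 t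
    induction t with
    | zero =>
      intro _ _ t' ht'
      obtain rfl : t' = 0 := by omega
      rw [hxx0, hxx0, hyy0', hyy0', h1, h2]
      exact ⟨rfl, rfl⟩
    | succ t ih =>
      intro hts hag t' ht'
      have ih' := ih (by omega) (fun t' h => hag t' (by omega))
      rcases Nat.lt_or_ge t' (t + 1) with hlt | hge
      · exact ih' t' (by omega)
      obtain rfl : t' = t + 1 := by omega
      have hY := hcausY ω ω' ℓ ⟨t, hts⟩ h2 (ih' t le_rfl).1 (ih' (t - 1) (by omega)).1
        (ih' t le_rfl).2
      simp only at hY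
      refine ⟨?_, hY⟩
      have hj := hag ⟨t, hts⟩ (by simp)
      have hk1 := hxkeep ω ℓ ⟨t, hts⟩
      have hk2 := hxkeep ω' ℓ ⟨t, hts⟩
      have hm1 := hxmem ω ℓ ⟨t, hts⟩
      have hm2 := hxmem ω' ℓ ⟨t, hts⟩
      have hn1 := hxmin ω ℓ ⟨t, hts⟩
      have hn2 := hxmin ω' ℓ ⟨t, hts⟩
      rw [← hj] at hk2 hm2 hn2
      simp only [← hY, ← (ih' t le_rfl).1, ← h1] at hk1 hk2 hm1 hm2 hn1 hn2
      refine PiLp.ext fun i => ?_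
      by_cases hi : i = ω ℓ ⟨t, hts⟩
      · rw [hi]
        exact rd_block_unique (f _) (hfd _) (Xi _) (hXcv _) μ ηc hμ hη0 (hfw _) _ _ _ _ _ hm1 hm2
          hn1 hn2
      · exact (hk1 i hi).trans (hk2 i hi).symm
  have hcausO : ∀ ω ω' l, l ≤ k → (∀ ℓ' : Fin k, ℓ'.1 < l → ω ℓ' = ω' ℓ') →
      xbar ω l = xbar ω' l ∧ xmbar ω l = xmbar ω' l := by
    intro ω ω' l
    induction l with
    | zero => intro _ _; simp only [hxbarinit, hxmbarinit, and_self]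
    | succ l ih =>
      intro hl hag
      obtain ⟨h1, h2⟩ := ih (by omega) (fun ℓ' h => hag ℓ' (by omega))
      have h3 := hcausI ω ω' ⟨l, hl⟩ h1 h2 s le_rfl
        (fun t' _ => by rw [hag ⟨l, hl⟩ (by simp)]) s le_rfl
      have hb1 := hxbarsucc ω ⟨l, hl⟩
      have hb2 := hxbarsucc ω' ⟨l, hl⟩
      have hw1 := hxmbarsucc ω ⟨l, hl⟩
      have hw2 := hxmbarsucc ω' ⟨l, hl⟩
      simp only [← h2, ← h3.2] at hb1 hb2 hw1 hw2
      refine ⟨by rw [hb1, hb2, h3.1], ?_⟩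
      refine rd_block_unique fm hfmd Set.univ convex_univ μ 0 hμ le_rfl
        (fun x _ y _ => hfmw x y) (xmbar ω l) 0 (yy ω ⟨l, hl⟩ s) _ _ trivial trivial ?_ ?_
      · intro z _
        have := hw1 z
        rw [real_inner_comm, real_inner_comm _ z] at this
        simpa using this
      · intro z _
        have := hw2 z
        rw [real_inner_comm, real_inner_comm _ z] at this
        simpa using this
  have hcausS : ∀ ω ω' (ℓ : Fin k), xbar ω ℓ.1 = xbar ω' ℓ.1 → xmbar ω ℓ.1 = xmbar ω' ℓ.1 →
      xstar ω ℓ = xstar ω' ℓ ∧ lam ω ℓ = lam ω' ℓ := by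
    intro ω ω' ℓ h1 h2
    have e2 := hxstaropt ω' ℓ
    rw [← h1, ← h2] at e2
    obtain ⟨h3, h4⟩ := rd_sub_unique f hfd Xi hXcv μ hμ hfw fm hfmd hfmw A AA hAA b _ _ _ _
      (hxstarX ω ℓ) (hxstarfeas ω ℓ) (hxstaropt ω ℓ) _ _ (hxstarX ω' ℓ) (hxstarfeas ω' ℓ) e2
    exact ⟨h3, by rw [hlam', hlam', h4, h2]⟩
  -- one-block differences
  have hdiff : ∀ ω (ℓ : Fin k) t, t ≤ s →
      ‖AA (xx ω ℓ t - xx ω ℓ (t - 1))‖ ≤ Abar * ‖xx ω ℓ t - xx ω ℓ (t - 1)‖ := by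
    intro ω ℓ t ht
    rcases t with _ | t
    · simp
    · refine rd_single_block A AA hAA Abar hAbar _ (ω ℓ ⟨t, ht⟩) ?_
      intro i hi
      have := hxkeep ω ℓ ⟨t, ht⟩ i hi
      simp only [Nat.add_sub_cancel, PiLp.sub_apply]
      rw [this, sub_self]
  -- dual optimality
  have hdual := fun ω (ℓ : Fin k) => rd_conj fm hfmd μ hμ hfmw (xmbar ω ℓ.1) (hF ω ℓ) (hhFd ω ℓ)
    (hhFdef ω ℓ) (lam ω ℓ) (xmstar ω ℓ) (hlam' ω ℓ)
  obtain ⟨Φ, hΦ⟩ : ∃ Φ : Fin k → ℕ → (Fin k → Fin s → Fin (m - 1)) → ℝ, ∀ ℓ t ω, Φ ℓ t ω =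
      P * (μ + ηc) / 2 * ‖xx ω ℓ t - xstar ω ℓ‖ ^ 2
      + ηc * P / 2 * ‖xx ω ℓ t - xx ω ℓ (t - 1)‖ ^ 2
      + (1 + τc) * breg (hF ω ℓ) (lam ω ℓ) (yy ω ℓ t)
      + P * ⟪AA (xx ω ℓ t - xx ω ℓ (t - 1)), yy ω ℓ t - lam ω ℓ⟫ := ⟨_, fun _ _ _ => rfl⟩
  have hstep : ∀ (ℓ : Fin k) (t : Fin s) ω,
      ∑ i, Φ ℓ (t.1 + 1) (Function.update ω ℓ (Function.update (ω ℓ) t i))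
        ≤ P * (α * Φ ℓ t.1 ω) := by
    intro ℓ t ω
    obtain ⟨U, hU⟩ : ∃ U : Fin (m - 1) → (Fin k → Fin s → Fin (m - 1)), ∀ i, 
      U i = Function.update ω ℓ (Function.update (ω ℓ) t i) := ⟨_, fun _ => rfl⟩
    simp only [← hU]
    have hUt : ∀ i, U i ℓ t = i := by intro i; rw [hU]; simp
    have hUO : ∀ i, xbar ω ℓ.1 = xbar (U i) ℓ.1 ∧ xmbar ω ℓ.1 = xmbar (U i) ℓ.1 := by
      intro i
      refine hcausO ω (U i) ℓ.1 ℓ.2.le ?_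
      intro ℓ' hl
      rw [hU, Function.update_of_ne (by intro h; rw [h] at hl; omega)]
    have hUI : ∀ i, ∀ t', t' ≤ t.1 → xx ω ℓ t' = xx (U i) ℓ t' ∧ yy ω ℓ t' = yy (U i) ℓ t' := by
      intro i
      refine hcausI ω (U i) ℓ (hUO i).1 (hUO i).2 t.1 t.2.le ?_
      intro t' ht'
      rw [hU, Function.update_self, Function.update_of_ne (by intro h; rw [h] at ht'; omega)]
    have hUY : ∀ i, yy ω ℓ (t.1 + 1) = yy (U i) ℓ (t.1 + 1) := fun i =>
      hcausY ω (U i) ℓ t (hUO i).2 (hUI i _ le_rfl).1 (hUI i _ (by omega)).1 (hUI i _ le_rfl).2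
    have hUS := fun i => hcausS ω (U i) ℓ (hUO i).1 (hUO i).2
    have hUF := fun i => hcausF ω (U i) ℓ (hUO i).2
    let xh : PiLp 2 fun i : Fin (m - 1) => EuclideanSpace ℝ (Fin (d i)) :=
      WithLp.toLp 2 (fun i => xx (U i) ℓ (t.1 + 1) i)
    have hxhi : ∀ i, xh i = xx (U i) ℓ (t.1 + 1) i := fun i => rfl
    have hxhk : ∀ i j, j ≠ i → xx (U i) ℓ (t.1 + 1) j = xx ω ℓ t.1 j := by
      intro i j hj
      rw [hxkeep (U i) ℓ t j (by rw [hUt]; exact hj), (hUI i _ le_rfl).1]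
    have hxhm : ∀ i, xh i ∈ Xi i := fun i => hmemx (U i) ℓ (t.1 + 1) t.2 i
    have hs1 := rd_sum_update_sq (xx ω ℓ t.1) (xstar ω ℓ) xh
      (fun i => xx (U i) ℓ (t.1 + 1)) (fun i => rfl) hxhk
    have hs2 := rd_sum_update_sq (xx ω ℓ t.1) (xx ω ℓ t.1) xh
      (fun i => xx (U i) ℓ (t.1 + 1)) (fun i => rfl) hxhk
    have hs3 := rd_sum_update (xx ω ℓ t.1) xh
      (fun i => xx (U i) ℓ (t.1 + 1)) (fun i => rfl) hxhk
    simp only [hcardP, sub_self, norm_zero] at hs1 hs2 hs3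
    -- the sum
    have hsum : ∑ i, Φ ℓ (t.1 + 1) (U i) = P * ((μ + ηc) / 2 * (‖xh - xstar ω ℓ‖ ^ 2
        + (P - 1) * ‖xx ω ℓ t.1 - xstar ω ℓ‖ ^ 2) + ηc / 2 * ‖xh - xx ω ℓ t.1‖ ^ 2
      + (1 + τc) * breg (hF ω ℓ) (lam ω ℓ) (yy ω ℓ (t.1 + 1))
      + ⟪AA (xh - xx ω ℓ t.1), yy ω ℓ (t.1 + 1) - lam ω ℓ⟫) := by
      have e : ∀ i, Φ ℓ (t.1 + 1) (U i) =
          P * (μ + ηc) / 2 * ‖xx (U i) ℓ (t.1 + 1) - xstar ω ℓ‖ ^ 2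
          + ηc * P / 2 * ‖xx (U i) ℓ (t.1 + 1) - xx ω ℓ t.1‖ ^ 2
          + (1 + τc) * breg (hF ω ℓ) (lam ω ℓ) (yy ω ℓ (t.1 + 1))
          + P * ⟪AA (xx (U i) ℓ (t.1 + 1) - xx ω ℓ t.1), yy ω ℓ (t.1 + 1) - lam ω ℓ⟫ := by
        intro i
        rw [hΦ, Nat.add_sub_cancel, ← (hUS i).1, ← (hUS i).2, ← hUF i, ← hUY i,
          ← (hUI i t.1 le_rfl).1]
      rw [Finset.sum_congr rfl (fun i _ => e i)]
      rw [Finset.sum_add_distrib, Finset.sum_add_distrib, Finset.sum_add_distrib,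
        ← Finset.mul_sum, ← Finset.mul_sum, ← Finset.mul_sum, ← Finset.mul_sum, hs1, hs2, ← sum_inner, ← map_sum, hs3,
        Finset.sum_const, Finset.card_univ, nsmul_eq_mul, hcardP]
      ring
    rw [hsum]
    refine mul_le_mul_of_nonneg_left ?_ (by linarith)
    rw [hΦ]
    -- three point
    have h3 := rd_three_point (hF ω ℓ) (hhFd ω ℓ) τc _ _ _ (hyymin ω ℓ t) (lam ω ℓ)
    refine rd_step P μ Lh Abar α τc ηc hP1 hLh0 hα0 hα1 hτ0 hτα hPμ h2P AA b
      (xx ω ℓ t.1) (xx ω ℓ (t.1 - 1)) (xstar ω ℓ) xh (yy ω ℓ (t.1 + 1)) (yy ω ℓ t.1) (lam ω ℓ)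
      ((∑ i, f i (xh i)) + μ * ‖xh - xbar ω ℓ.1‖ ^ 2)
      ((∑ i, f i (xstar ω ℓ i)) + μ * ‖xstar ω ℓ - xbar ω ℓ.1‖ ^ 2)
      (hF ω ℓ (yy ω ℓ (t.1 + 1))) (hF ω ℓ (lam ω ℓ))
      (breg (hF ω ℓ) (yy ω ℓ (t.1 + 1)) (yy ω ℓ t.1)) _ _ ?_ ?_ ?_ ?_ ?_ (hdiff ω ℓ t.1 t.2.le)
    · have hb : ∀ i, f i (xh i) + μ * ‖xh i - xbar ω ℓ.1 i‖ ^ 2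
          - (f i (xstar ω ℓ i) + μ * ‖xstar ω ℓ i - xbar ω ℓ.1 i‖ ^ 2)
          + ⟪ContinuousLinearMap.adjoint (A i) (yy ω ℓ (t.1 + 1)), xh i - xstar ω ℓ i⟫
          + ηc / 2 * ‖xh i - xx ω ℓ t.1 i‖ ^ 2 + (μ + ηc) / 2 * ‖xh i - xstar ω ℓ i‖ ^ 2
          ≤ ηc / 2 * ‖xx ω ℓ t.1 i - xstar ω ℓ i‖ ^ 2 := by
        intro i
        have hmin := hxmin (U i) ℓ t
        have hmem := hxmem (U i) ℓ t
        rw [hUt] at hmin hmem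
        rw [← hUY i, ← (hUO i).1, ← (hUI i t.1 le_rfl).1, ← hxhi] at hmin
        rw [← hxhi] at hmem
        have := rd_block_min (f i) (hfd i) (Xi i) (hXcv i) μ ηc (hfw i) _ _ _ _ hmem hmin
          (xstar ω ℓ i) (hxstarX ω ℓ i)
        rw [norm_sub_rev (xstar ω ℓ i) (xx ω ℓ t.1 i)] at this
        rw [inner_sub_right]
        linarith
      have hb2 := Finset.sum_le_sum (fun i (_ : i ∈ (Finset.univ : Finset (Fin (m - 1)))) => hb i)
      rw [rd_inner_AA A AA hAA]
      have hnsq : ∀ v : PiLp 2 (fun i => EuclideanSpace ℝ (Fin (d i))), ‖v‖ ^ 2 = ∑ i, ‖v i‖ ^ 2 :=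
        fun v => PiLp.norm_sq_eq_of_L2 _ v
      simp only [hnsq, PiLp.sub_apply]
      simp only [Finset.sum_add_distrib, Finset.sum_sub_distrib, ← Finset.mul_sum] at hb2
      linarith
    · refine le_trans ?_ (hstrong ω ℓ xh hxhm)
      positivity
    · simp only [breg]
      rw [inner_sub_right]
      linarith
    · have h4 := hhFsc ω ℓ (yy ω ℓ (t.1 + 1)) (lam ω ℓ)
      rw [(hdual ω ℓ).2, inner_neg_left] at h4
      rw [← hxstarfeas ω ℓ, add_sub_cancel_left]
      have : 0 ≤ 1 / Lh / 2 * ‖yy ω ℓ (t.1 + 1) - lam ω ℓ‖ ^ 2 := by positivity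
      linarith
    · exact hhFsc ω ℓ _ _
  have hPpos : 0 < P := by linarith
  have hstep2 : ∀ (ℓ : Fin k) (t : Fin s), ∑ ω, Φ ℓ (t.1 + 1) ω ≤ α * ∑ ω, Φ ℓ t.1 ω := by
    intro ℓ t
    have h1 := Finset.sum_le_sum (fun ω (_ : ω ∈ Finset.univ) => hstep ℓ t ω)
    rw [rd_avg ℓ t (Φ ℓ (t.1 + 1)), hcardP, ← Finset.mul_sum, ← Finset.mul_sum] at h1
    exact le_of_mul_le_mul_left h1 hPpos
  have hiter : ∀ (ℓ : Fin k) t, t ≤ s → ∑ ω, Φ ℓ t ω ≤ α ^ t * ∑ ω, Φ ℓ 0 ω := by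
    intro ℓ t
    induction t with
    | zero => intro _; simp
    | succ t ih =>
      intro ht
      have h1 := hstep2 ℓ ⟨t, ht⟩
      have h2 := mul_le_mul_of_nonneg_left (ih (by omega)) hα0
      simp only at h1
      rw [pow_succ]
      linarith
  -- inner convergence
  obtain ⟨a, ha⟩ : ∃ a : Fin k → ℝ, ∀ ℓ : Fin k, a ℓ = ∑ ω, (‖xstar ω ℓ - xbar ω ℓ.1‖ ^ 2
      + ‖xmstar ω ℓ - xmbar ω ℓ.1‖ ^ 2) := ⟨_, fun _ => rfl⟩
  obtain ⟨e, he⟩ : ∃ e : Fin k → ℝ, ∀ ℓ : Fin k, e ℓ = ∑ ω, (‖xbar ω (ℓ.1 + 1) - xstar ω ℓ‖ ^ 2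
      + ‖xmbar ω (ℓ.1 + 1) - xmstar ω ℓ‖ ^ 2) := ⟨_, fun _ => rfl⟩
  have ha0 : ∀ ℓ, 0 ≤ a ℓ := fun ℓ => by rw [ha]; exact Finset.sum_nonneg fun ω _ => by positivity
  have h1τ0 : 0 < 1 + τc := by linarith
  have hinner : ∀ ℓ, e ℓ ≤ (4 + 2 * L / μ) * α ^ s * a ℓ := by
    intro ℓ
    have hlow : ∀ ω, (1 + τc) / 2 * (μ / 2 * (‖xbar ω (ℓ.1 + 1) - xstar ω ℓ‖ ^ 2
        + ‖xmbar ω (ℓ.1 + 1) - xmstar ω ℓ‖ ^ 2)) ≤ Φ ℓ s ω := by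
      intro ω
      have h1 := rd_terminal P μ Lh Abar α τc ηc hP1 hLh0 hα1 h1τ hPμ h2P
        (AA (xx ω ℓ s - xx ω ℓ (s - 1))) ‖xx ω ℓ s - xx ω ℓ (s - 1)‖
        (‖xx ω ℓ s - xstar ω ℓ‖ ^ 2) (yy ω ℓ s) (lam ω ℓ)
        (breg (hF ω ℓ) (lam ω ℓ) (yy ω ℓ s)) (hhFsc ω ℓ _ _) (hdiff ω ℓ s le_rfl)
      rw [hΦ]
      refine le_trans ?_ h1
      refine mul_le_mul_of_nonneg_left ?_ (by linarith)
      have h2 : breg (hF ω ℓ) (lam ω ℓ) (yy ω ℓ s) = _ :=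
        rd_conj_breg fm hfmd μ hμ hfmw _ (hF ω ℓ) (hhFd ω ℓ)
        (hhFdef ω ℓ) _ _ (hyys ω ℓ) _ _ (hlam' ω ℓ)
      have h3 := hfmw (xmbar ω (ℓ.1 + 1)) (xmstar ω ℓ)
      rw [h2, hxbarsucc]
      have h4 : 0 ≤ μ / 2 * ‖xx ω ℓ s - xstar ω ℓ‖ ^ 2 := by positivity
      linarith
    have hup : ∀ ω, Φ ℓ 0 ω ≤ (1 + τc) / 2 * (Lh * (‖xstar ω ℓ - xbar ω ℓ.1‖ ^ 2
      + ‖xmstar ω ℓ - xmbar ω ℓ.1‖ ^ 2)) := by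
      intro ω
      rw [hΦ, hPμ]
      have h2 : breg (hF ω ℓ) (lam ω ℓ) (yy ω ℓ 0) = _ :=
        rd_conj_breg fm hfmd μ hμ hfmw _ (hF ω ℓ) (hhFd ω ℓ)
        (hhFdef ω ℓ) _ _ (hyy0' ω ℓ) _ _ (hlam' ω ℓ)
      have h3 := rd_descent fm hfmd L hfmLip (xmbar ω ℓ.1) (xmstar ω ℓ)
      have h5 : breg (hF ω ℓ) (lam ω ℓ) (yy ω ℓ 0) ≤ Lh / 2 * ‖xmbar ω ℓ.1 - xmstar ω ℓ‖ ^ 2 := by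
        rw [h2, hLh]; linarith
      have h6 := mul_le_mul_of_nonneg_left h5 h1τ0.le
      have h7 : μ * ‖xbar ω ℓ.1 - xstar ω ℓ‖ ^ 2 ≤ Lh * ‖xbar ω ℓ.1 - xstar ω ℓ‖ ^ 2 :=
        mul_le_mul_of_nonneg_right (by rw [hLh]; linarith) (sq_nonneg _)
      have h8 := mul_le_mul_of_nonneg_left h7 h1τ0.le
      rw [hxx0, norm_sub_rev (xstar ω ℓ), norm_sub_rev (xmstar ω ℓ)]
      simp only [Nat.zero_sub, hxx0, sub_self, map_zero, inner_zero_left, norm_zero]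
      linarith
    have h1 := Finset.sum_le_sum (fun ω (_ : ω ∈ Finset.univ) => hlow ω)
    have h2 := Finset.sum_le_sum (fun ω (_ : ω ∈ Finset.univ) => hup ω)
    rw [← Finset.mul_sum, ← Finset.mul_sum, ← he] at h1
    rw [← Finset.mul_sum, ← Finset.mul_sum, ← ha] at h2
    have h3 := hiter ℓ s le_rfl
    have h4 := mul_le_mul_of_nonneg_left h2 (pow_nonneg hα0 s)
    have h5 : (1 + τc) / 2 * (μ / 2 * e ℓ) ≤ (1 + τc) / 2 * (α ^ s * (Lh * a ℓ)) := by linarith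
    have h6 := le_of_mul_le_mul_left h5 (by linarith)
    have h7 : (4 + 2 * L / μ) * α ^ s * a ℓ = 2 / μ * (α ^ s * (Lh * a ℓ)) := by
      rw [hLh]; field_simp; ring
    have h8 : e ℓ = 2 / μ * (μ / 2 * e ℓ) := by field_simp
    rw [h7, h8]
    exact mul_le_mul_of_nonneg_left h6 (by positivity)
  have hin1 : ∀ ℓ, e ℓ ≤ 1 / 2 * a ℓ := fun ℓ => (hinner ℓ).trans
    (mul_le_mul_of_nonneg_right (hsM.trans (min_le_left _ _)) (ha0 ℓ))
  have hin2 : ∀ ℓ, e ℓ ≤ μ ^ 2 / L ^ 2 * a ℓ := fun ℓ => (hinner ℓ).trans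
    (mul_le_mul_of_nonneg_right (hsM.trans (min_le_right _ _)) (ha0 ℓ))
  -- outer convergence
  obtain ⟨N, hN⟩ : ∃ N : ℝ, N = (Fintype.card (Fin k → Fin s → Fin (m - 1)) : ℝ) := ⟨_, rfl⟩
  have hNpos : 0 < N := by
    rw [hN]
    have : Nonempty (Fin (m - 1)) := ⟨⟨0, by omega⟩⟩
    exact_mod_cast Fintype.card_pos
  obtain ⟨D, hD⟩ : ∃ D : ℝ, D = (∑ i, f i (xbar0 i)) + fm xmbar0 - (∑ i, f i (xopt i)) - fm xmopt :=
    ⟨_, rfl⟩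
  have hD0 : 0 ≤ D := by
    have := hxopt xbar0 xmbar0 hxbar0X hfeas0
    rw [hD]; linarith
  have hout : μ / 2 * ∑ ℓ, a ℓ ≤ N * D := by
    have := rd_outer k hk a (fun ℓ => ∑ ω, ((∑ i, f i (xstar ω ℓ i)) + fm (xmstar ω ℓ))) μ
      (N * ((∑ i, f i (xbar0 i)) + fm xmbar0)) (N * ((∑ i, f i (xopt i)) + fm xmopt)) hμ ha0 ?_ ?_ ?_
    · refine this.trans (le_of_eq ?_)
      rw [hD]; ring
    · intro ℓ
      have := Finset.sum_le_sum (fun ω (_ : ω ∈ (Finset.univ : Finset (Fin k → Fin s → Fin (m - 1))))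
        => hxopt _ _ (hxstarX ω ℓ) (hxstarfeas ω ℓ))
      rw [Finset.sum_const, Finset.card_univ, nsmul_eq_mul, ← hN] at this
      exact this
    · rw [ha, Finset.mul_sum, ← Finset.sum_add_distrib]
      have := Finset.sum_le_sum (fun ω (_ : ω ∈ (Finset.univ : Finset (Fin k → Fin s → Fin (m - 1))))
        => hxstaropt ω ⟨0, hk⟩ xbar0 xmbar0 hxbar0X hfeas0)
      simp only [hxbarinit, hxmbarinit, sub_self, norm_zero] at this ⊢
      rw [Finset.sum_const, Finset.card_univ, nsmul_eq_mul, ← hN] at this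
      refine le_trans (le_of_eq ?_) (this.trans (le_of_eq ?_))
      · apply Finset.sum_congr rfl; intro ω _; ring
      · ring
    · intro j hj
      have h1 := Finset.sum_le_sum (fun ω (_ : ω ∈ (Finset.univ : Finset (Fin k → Fin s → Fin (m - 1))))
        => hxstaropt ω ⟨j + 1, hj⟩ _ _ (hxstarX ω ⟨j, by omega⟩) (hxstarfeas ω ⟨j, by omega⟩))
      have h2 := hin1 ⟨j, by omega⟩
      have h3 := mul_le_mul_of_nonneg_left h2 hμ.le
      rw [he] at h3
      rw [ha ⟨j + 1, hj⟩]
      simp only [fun ω => norm_sub_rev (xbar ω (j + 1)) (xstar ω ⟨j, by omega⟩),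
        fun ω => norm_sub_rev (xmbar ω (j + 1)) (xmstar ω ⟨j, by omega⟩)] at h3
      simp only [Finset.sum_add_distrib, ← Finset.mul_sum] at h1 h3 ⊢
      linarith
  have hS : ∑ ℓ, a ℓ ≤ 2 / μ * (N * D) := by
    have := mul_le_mul_of_nonneg_left hout (by positivity : 0 ≤ 2 / μ)
    have e1 : 2 / μ * (μ / 2 * ∑ ℓ, a ℓ) = ∑ ℓ, a ℓ := by field_simp
    linarith
  have hkpos : (0 : ℝ) < k := by exact_mod_cast hk
  -- generic conclusion
  have hgen : ∀ (G : (Fin k → Fin s → Fin (m - 1)) → Fin k → ℝ) (K : ℝ), 0 ≤ K →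
      (∀ ℓ, ∑ ω, G ω ℓ ≤ K * a ℓ) →
      (k : ℝ)⁻¹ * ∑ ℓ : Fin k, (Fintype.card (Fin k → Fin s → Fin (m - 1)) : ℝ)⁻¹ *
          ∑ ω : Fin k → Fin s → Fin (m - 1), G ω ℓ ≤ K * (2 / μ) / k * D := by
    intro G K hK hG
    rw [← hN, ← Finset.mul_sum]
    have h1 := Finset.sum_le_sum (fun ℓ (_ : ℓ ∈ (Finset.univ : Finset (Fin k))) => hG ℓ)
    rw [← Finset.mul_sum] at h1
    have h2 := h1.trans (mul_le_mul_of_nonneg_left hS hK)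
    have h3 := mul_le_mul_of_nonneg_left h2 (by positivity : 0 ≤ (k : ℝ)⁻¹ * N⁻¹)
    rw [← mul_assoc]
    refine h3.trans (le_of_eq ?_)
    field_simp
  rw [← hD]
  refine ⟨?_, ?_, ?_, ?_⟩
  · refine (hgen _ (4 * μ ^ 2) (by positivity) ?_).trans (le_of_eq (by field_simp; ring))
    intro ℓ
    rw [ha, Finset.mul_sum]
    apply Finset.sum_le_sum
    intro ω _
    have hv : ((2 * μ) • (xstar ω ℓ - xbar ω ℓ.1) +
        (WithLp.equiv 2 (∀ i : Fin (m - 1), EuclideanSpace ℝ (Fin (d i)))).symm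
                (fun i => gradient (f i) (xstar ω ℓ i)
                  + ContinuousLinearMap.adjoint (A i) (lam ω ℓ))) ∈ 
         {v : PiLp 2 fun i : Fin (m - 1) => EuclideanSpace ℝ (Fin (d i)) |
                ∀ yx, (∀ i, yx i ∈ Xi i) → ⟪-v, yx - xstar ω ℓ⟫ ≤ 0} := by
      intro yx hyx
      have h1 := hkkt ω ℓ yx hyx
      rw [inner_neg_left, PiLp.inner_apply, neg_nonpos]
      refine h1.trans (le_of_eq ?_)
      apply Finset.sum_congr rfl
      intro i _
      congr 1
      simp only [PiLp.add_apply, PiLp.smul_apply, PiLp.sub_apply, WithLp.equiv_symm_apply]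
      abel
    have h1 := Metric.infDist_le_dist_of_mem (x := ((WithLp.equiv 2
      (∀ i : Fin (m - 1), EuclideanSpace ℝ (Fin (d i)))).symm
                (fun i => gradient (f i) (xstar ω ℓ i)
                  + ContinuousLinearMap.adjoint (A i) (lam ω ℓ)))) hv
    rw [dist_eq_norm, sub_add_cancel_right, norm_neg, norm_smul, Real.norm_of_nonneg (by linarith)]
      at h1
    have h2 := pow_le_pow_left₀ Metric.infDist_nonneg h1 2
    refine h2.trans ?_
    have h3 : 0 ≤ 4 * μ ^ 2 * ‖xmstar ω ℓ - xmbar ω ℓ.1‖ ^ 2 := by positivity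
    nlinarith
  · have hfin : (10 * μ ^ 2) * (2 / μ) / k * D ≤ 34 * μ / k * D := by
      have : (10 * μ ^ 2) * (2 / μ) / k = 20 * μ / k := by field_simp; ring
      rw [this]
      refine mul_le_mul_of_nonneg_right ?_ hD0
      refine div_le_div_of_nonneg_right ?_ hkpos.le
      linarith
    refine (hgen _ (10 * μ ^ 2) (by positivity) ?_).trans hfin
    intro ℓ
    have h1 : ∑ ω, ‖gradient fm (xmbar ω (ℓ.1 + 1)) + lam ω ℓ‖ ^ 2 ≤ 
        ∑ ω, (2 * L ^ 2 * (‖xbar ω (ℓ.1 + 1) - xstar ω ℓ‖ ^ 2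
          + ‖xmbar ω (ℓ.1 + 1) - xmstar ω ℓ‖ ^ 2) + 8 * μ ^ 2 * (‖xstar ω ℓ - xbar ω ℓ.1‖ ^ 2
          + ‖xmstar ω ℓ - xmbar ω ℓ.1‖ ^ 2)) := by
      apply Finset.sum_le_sum
      intro ω _
      have e1 : gradient fm (xmbar ω (ℓ.1 + 1)) + lam ω ℓ = 
          (gradient fm (xmbar ω (ℓ.1 + 1)) - gradient fm (xmstar ω ℓ))
          - (2 * μ) • (xmstar ω ℓ - xmbar ω ℓ.1) := by rw [hlam']; abel
      have h2 := norm_sub_le (gradient fm (xmbar ω (ℓ.1 + 1)) - gradient fm (xmstar ω ℓ))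
        ((2 * μ) • (xmstar ω ℓ - xmbar ω ℓ.1))
      have h3 := hfmLip (xmbar ω (ℓ.1 + 1)) (xmstar ω ℓ)
      rw [norm_smul, Real.norm_of_nonneg (by linarith : 0 ≤ 2 * μ)] at h2
      rw [e1]
      have h4 := pow_le_pow_left₀ (norm_nonneg _) (h2.trans (add_le_add_left h3 _)) 2
      refine h4.trans ?_
      have h5 : 0 ≤ 2 * L ^ 2 * ‖xbar ω (ℓ.1 + 1) - xstar ω ℓ‖ ^ 2 := by positivity
      have h6 : 0 ≤ 8 * μ ^ 2 * ‖xstar ω ℓ - xbar ω ℓ.1‖ ^ 2 := by positivity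
      have h7 := sq_nonneg (L * ‖xmbar ω (ℓ.1 + 1) - xmstar ω ℓ‖
        - 2 * μ * ‖xmstar ω ℓ - xmbar ω ℓ.1‖)
      linarith
    refine h1.trans ?_
    rw [Finset.sum_add_distrib, ← Finset.mul_sum, ← Finset.mul_sum, ← ha, ← he]
    have h2 := mul_le_mul_of_nonneg_left (hin2 ℓ) (by positivity : 0 ≤ 2 * L ^ 2)
    have h3 : 2 * L ^ 2 * (μ ^ 2 / L ^ 2 * a ℓ) = 2 * μ ^ 2 * a ℓ := by field_simp
    linarith
  · refine (hgen _ (μ ^ 2 / L ^ 2) (by positivity) ?_).trans (le_of_eq (by field_simp))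
    intro ℓ
    refine le_trans ?_ (hin2 ℓ)
    rw [he]
    apply Finset.sum_le_sum
    intro ω _
    have : 0 ≤ ‖xmbar ω (ℓ.1 + 1) - xmstar ω ℓ‖ ^ 2 := by positivity
    linarith
  · refine (hgen _ ((‖AA‖ ^ 2 + 1) * (μ ^ 2 / L ^ 2)) (by positivity) ?_).trans
      (le_of_eq (by field_simp))
    intro ℓ
    rw [mul_assoc]
    refine le_trans ?_ (mul_le_mul_of_nonneg_left (hin2 ℓ) (by positivity))
    rw [he, Finset.mul_sum]
    apply Finset.sum_le_sum
    intro ω _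
    have e1 : AA (xbar ω (ℓ.1 + 1)) + xmbar ω (ℓ.1 + 1) - b = 
        AA (xbar ω (ℓ.1 + 1) - xstar ω ℓ) + (xmbar ω (ℓ.1 + 1) - xmstar ω ℓ) := by
      rw [← hxstarfeas ω ℓ, map_sub]; abel
    rw [e1]
    have h2 := norm_add_le (AA (xbar ω (ℓ.1 + 1) - xstar ω ℓ))
      (xmbar ω (ℓ.1 + 1) - xmstar ω ℓ)
    have h3 := AA.le_opNorm (xbar ω (ℓ.1 + 1) - xstar ω ℓ)
    have h4 := pow_le_pow_left₀ (norm_nonneg _) (h2.trans (add_le_add_left h3 _)) 2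
    refine h4.trans ?_
    have h7 := sq_nonneg (‖AA‖ * ‖xmbar ω (ℓ.1 + 1) - xmstar ω ℓ‖
        - ‖xbar ω (ℓ.1 + 1) - xstar ω ℓ‖)
    nlinarith
end

section
/- (Verification of the RaGrad stepsize conditions for the parameters of Theorem 1/Theorem 2.) Let m ≥ 2 be an integer, 0 < μ ≤ L reals, L̂ = L + 2μ, c = 2 + L/μ, α = 1 − 2/(m(√(1 + 16c/m) + 1)), τ = 1/(m(1−α)) − 1, and η = α/(1−α). Then 0 < α < 1, τ > 0, η > 0, and the following inequalities hold: (i) m(1+τ) − 1 ≤ α·m(1+τ); (ii) η ≤ α(1+η); (iii) ημ/4 ≥ (m−1)²L̂/(m²τ); (iv) ημ/2 ≥ αL̂/τ + (m−1)²L̂/(m²τ); (v) ημ/4 ≥ L̂/(m(1+τ)). -/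
/-- Verification of the RaGrad stepsize conditions for the parameters of
Theorem 1 / Theorem 2. -/
theorem stmt14 (m : ℕ) (hm : 2 ≤ m) (μ L Lh c α τ η : ℝ)
    (hμ : 0 < μ) (hμL : μ ≤ L)
    (hLh : Lh = L + 2 * μ) (hc : c = 2 + L / μ)
    (hα : α = 1 - 2 / (m * (Real.sqrt (1 + 16 * c / m) + 1)))
    (hτ : τ = 1 / (m * (1 - α)) - 1) (hη : η = α / (1 - α)) :
    0 < α ∧ α < 1 ∧ 0 < τ ∧ 0 < η ∧
    (m : ℝ) * (1 + τ) - 1 ≤ α * ((m : ℝ) * (1 + τ)) ∧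
    η ≤ α * (1 + η) ∧
    η * μ / 4 ≥ ((m : ℝ) - 1) ^ 2 * Lh / ((m : ℝ) ^ 2 * τ) ∧
    η * μ / 2 ≥ α * Lh / τ + ((m : ℝ) - 1) ^ 2 * Lh / ((m : ℝ) ^ 2 * τ) ∧
    η * μ / 4 ≥ Lh / ((m : ℝ) * (1 + τ)) := by
  have hM : (2 : ℝ) ≤ (m : ℝ) := by exact_mod_cast hm
  generalize (m : ℝ) = M at *
  have hM0 : 0 < M := by linarith
  have hcpos : 0 < c := by
    have : 0 < L / μ := div_pos (by linarith) hμ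
    linarith
  have hq : 0 < 16 * c / M := by positivity
  have hs2 : Real.sqrt (1 + 16 * c / M) ^ 2 = 1 + 16 * c / M := Real.sq_sqrt (by linarith)
  have hs0 : 0 ≤ Real.sqrt (1 + 16 * c / M) := Real.sqrt_nonneg _
  generalize Real.sqrt (1 + 16 * c / M) = s at *
  have hs : 1 < s := by nlinarith
  have hs1 : 0 < s - 1 := by linarith
  have hsp : 0 < s + 1 := by linarith
  have hcs : c = M * (s ^ 2 - 1) / 16 := by
    rw [hs2]; field_simp; ring
  have hLc : Lh = M * (s - 1) * (s + 1) / 16 * μ := by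
    have h1 : Lh = c * μ := by rw [hLh, hc]; field_simp; ring
    rw [h1, hcs]; ring
  have hA : 1 - α = 2 / (M * (s + 1)) := by rw [hα]; ring
  have hα' : α = (M * (s + 1) - 2) / (M * (s + 1)) := by
    rw [hα]; field_simp
  have hτ' : τ = (s - 1) / 2 := by
    rw [hτ, hA]; field_simp; ring
  have hη' : η = (M * (s + 1) - 2) / 2 := by
    rw [hη, hA, hα']; field_simp
  have hP : 0 < M * (s + 1) - 2 := by nlinarith
  have e1 : (M - 1) ^ 2 * Lh / (M ^ 2 * τ) = (M - 1) ^ 2 * (s + 1) / (8 * M) * μ := by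
    rw [hLc, hτ']; field_simp; ring
  have e2 : α * Lh / τ = η * μ / 4 := by
    rw [hLc, hτ', hα', hη']; field_simp; ring
  have e3 : Lh / (M * (1 + τ)) = (s - 1) / 8 * μ := by
    have : 1 + τ = (s + 1) / 2 := by rw [hτ']; ring
    rw [hLc, this]; field_simp; ring
  have h3 : η * μ / 4 ≥ (M - 1) ^ 2 * Lh / (M ^ 2 * τ) := by
    rw [e1, hη']
    have : (M - 1) ^ 2 * (s + 1) / (8 * M) ≤ (M * (s + 1) - 2) / 8 := by
      rw [div_le_div_iff₀ (by positivity) (by norm_num)]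
      nlinarith [mul_pos hM0 hs1]
    nlinarith [mul_le_mul_of_nonneg_right this hμ.le]
  have hα0 : 0 < α := by rw [hα']; positivity
  have hα1 : 0 < 1 - α := by rw [hA]; positivity
  refine ⟨hα0, by linarith, by rw [hτ']; linarith, by rw [hη']; linarith, ?_, ?_, h3, ?_, ?_⟩
  · have : M * (1 + τ) * (1 - α) = 1 := by
      rw [hA, hτ']; field_simp; ring
    linarith
  · have : η * (1 - α) = α := by rw [hη]; field_simp
    linarith
  · rw [e2]; linarith
  · rw [e3, hη']
    have : (s - 1) / 8 ≤ (M * (s + 1) - 2) / 8 := by nlinarith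
    nlinarith [mul_le_mul_of_nonneg_right this hμ.le]
end

section
/- (Verification of the RaDual stepsize conditions for the parameters of Theorem 3/Theorem 4.) Let m ≥ 2 be an integer, μ > 0, L̂ ≥ μ and Ā > 0 reals, μ̄ = 1/L̂, c = Ā²/(μμ̄) = L̂Ā²/μ, α = 1 − 2/((m−1)(√(1+8c)+1)), τ = α/(1−α), and η = ((α − (m−2)/(m−1))μ)/(1−α). Then (m−2)/(m−1) < α < 1 (in particular η > 0 and τ > 0), and the following inequalities hold: (i) (m−1)η + (m−2)μ ≤ α(m−1)(η + μ); (ii) τ ≤ α(τ + 1); (iii) 2(m−1)αĀ² ≤ μ̄·η·τ. -/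
/-- Verification of the RaDual stepsize conditions for the parameters of
Theorem 3 / Theorem 4. -/
theorem stmt15 (m : ℕ) (hm : 2 ≤ m) (μ Lh Abar μbar c α τ η : ℝ)
    (hμ : 0 < μ) (hL : μ ≤ Lh) (hA : 0 < Abar)
    (hμbar : μbar = 1 / Lh) (hc : c = Abar ^ 2 / (μ * μbar))
    (hc' : c = Lh * Abar ^ 2 / μ)
    (hα : α = 1 - 2 / (((m : ℝ) - 1) * (Real.sqrt (1 + 8 * c) + 1)))
    (hτ : τ = α / (1 - α))
    (hη : η = (α - ((m : ℝ) - 2) / ((m : ℝ) - 1)) * μ / (1 - α)) :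
    ((m : ℝ) - 2) / ((m : ℝ) - 1) < α ∧ α < 1 ∧ 0 < η ∧ 0 < τ ∧
    ((m : ℝ) - 1) * η + ((m : ℝ) - 2) * μ ≤ α * (((m : ℝ) - 1) * (η + μ)) ∧
    τ ≤ α * (τ + 1) ∧
    2 * ((m : ℝ) - 1) * α * Abar ^ 2 ≤ μbar * η * τ := by
  have hLp : 0 < Lh := lt_of_lt_of_le hμ hL
  have hcp : 0 < c := by rw [hc']; positivity
  have hm' : (2 : ℝ) ≤ (m : ℝ) := by exact_mod_cast hm
  obtain ⟨n, hn⟩ : ∃ n : ℝ, n = (m : ℝ) - 1 := ⟨_, rfl⟩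
  have hm2 : (m : ℝ) - 2 = n - 1 := by rw [hn]; ring
  rw [hm2, ← hn] at hη ⊢
  rw [← hn] at hα
  have hn1 : 1 ≤ n := by linarith
  have hn0 : 0 < n := by linarith
  obtain ⟨s, hs⟩ : ∃ s : ℝ, s = Real.sqrt (1 + 8 * c) := ⟨_, rfl⟩
  rw [← hs] at hα
  have hs2 : s ^ 2 = 1 + 8 * c := by rw [hs]; exact Real.sq_sqrt (by linarith)
  have hs0 : 0 ≤ s := by rw [hs]; exact Real.sqrt_nonneg _
  have hs1 : 1 < s := by nlinarith
  have hsp : 0 < s + 1 := by linarith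
  have hd : 1 - α = 2 / (n * (s + 1)) := by rw [hα]; ring
  have hd0 : 0 < 1 - α := by rw [hd]; positivity
  have hdiff : α - (n - 1) / n = (s - 1) / (n * (s + 1)) := by
    rw [hα]; field_simp; ring
  have hdiff0 : 0 < α - (n - 1) / n := by
    rw [hdiff]; exact div_pos (by linarith) (by positivity)
  have hq : 0 ≤ (n - 1) / n := div_nonneg (by linarith) hn0.le
  have hα0 : 0 < α := by linarith
  have hη' : η = μ * (s - 1) / 2 := by
    rw [hη, hdiff, hd]; field_simp
  have hτ' : τ = α * (n * (s + 1)) / 2 := by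
    rw [hτ, hd]; field_simp
  have hτd : τ * (1 - α) = α := by rw [hτ]; field_simp
  have hηd : η * (1 - α) = (α - (n - 1) / n) * μ := by rw [hη]; field_simp
  have hηn : n * (η * (1 - α)) = (n * α - (n - 1)) * μ := by
    rw [hηd]; field_simp
  have hcμ : μbar * μ * c = Abar ^ 2 := by
    rw [hc', hμbar]; field_simp
  refine ⟨by linarith, by linarith, ?_, ?_, by linarith, by linarith, ?_⟩
  · rw [hη']; have : 0 < s - 1 := by linarith
    positivity
  · rw [hτ']; positivity
  · apply le_of_eq
    rw [hη', hτ', ← hcμ]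
    linear_combination (-(μbar * μ * n * α) / 4) * hs2
end
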